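/- arXiv:2605.30101 — 3 statements merged into one kernel-verified Lean document; each statement's English description precedes it below -/
import Mathlib

section
/- Let H be a loopless edge-colored multigraph on w ≥ 2 vertices with color set [m], such that every color class is a matching. Suppose for some γ > 0 that every nonempty A ⊆ V(H) with |A| ≤ w/2 has at least γ·m·log(w/|A|) distinct colors crossing the cut (A, V∖A). Let 0 < η < 1 and let I be a uniformly random T-element subset of [m] with T ≤ m and T ≥ (4/γ)(log log(4w) + log(1/η) + 1). Then the spanning subgraph H[I] containing exactly the edges whose colors lie in I is connected with probability at least 1 − η. -/
/-- The multigraph restricted to the colors in `I`, as a simple graph. -/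
def colGraph {V E : Type*} {m : ℕ} (ends : E → V × V) (color : E → Fin m) (I : Finset (Fin m)) :
    SimpleGraph V :=
  SimpleGraph.fromRel (fun v u : V => ∃ e, color e ∈ I ∧ ends e = (v, u))

/-- The color `c` crosses the cut given by `A`. -/
def crosses {V E : Type*} {m : ℕ} (ends : E → V × V) (color : E → Fin m) (A : Finset V)
    (c : Fin m) : Prop :=
  ∃ e, color e = c ∧
    (((ends e).1 ∈ A ∧ (ends e).2 ∉ A) ∨ ((ends e).1 ∉ A ∧ (ends e).2 ∈ A))

lemma fiber_bound {α β : Type*} [Fintype α] [Fintype β] [DecidableEq α] [DecidableEq β]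
    (f : α → β) (hf : Function.Surjective f) (X : Finset α)
    (hX : ∀ a ∈ X, ∃ a', a' ≠ a ∧ f a' = f a) :
    X.card + 2 * Fintype.card β ≤ 2 * Fintype.card α := by
  have h1 : X.card = ∑ b : β, (X.filter (fun a => f a = b)).card :=
    Finset.card_eq_sum_card_fiberwise (fun _ _ => Finset.mem_univ _)
  have h2 : Fintype.card α = ∑ b : β, (Finset.univ.filter (fun a => f a = b)).card :=
    Finset.card_eq_sum_card_fiberwise (s := Finset.univ) (fun _ _ => Finset.mem_univ _)
  have h3 : Fintype.card β = ∑ b : β, 1 := by simp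
  rw [h1, h2, h3, Finset.mul_sum, Finset.mul_sum, ← Finset.sum_add_distrib]
  apply Finset.sum_le_sum
  intro b _
  have hle : (X.filter (fun a => f a = b)).card ≤ (Finset.univ.filter (fun a => f a = b)).card :=
    Finset.card_le_card (Finset.filter_subset_filter _ (Finset.subset_univ _))
  obtain ⟨a0, ha0⟩ := hf b
  have hpos : 0 < (Finset.univ.filter (fun a => f a = b)).card :=
    Finset.card_pos.mpr ⟨a0, by simp [ha0]⟩
  rcases Finset.eq_empty_or_nonempty (X.filter (fun a => f a = b)) with h | ⟨a, ha⟩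
  · rw [h]; simp only [Finset.card_empty]; omega
  · rw [Finset.mem_filter] at ha
    obtain ⟨a', hne, he⟩ := hX a ha.1
    have : 1 < (Finset.univ.filter (fun a => f a = b)).card :=
      Finset.one_lt_card.mpr ⟨a, by simp [ha.2], a', by simp [he, ha.2], hne.symm⟩
    omega

lemma size_ineq {ι : Type*} [Fintype ι] (s : ι → ℝ) (w : ℝ) (hs : ∀ i, 0 < s i)
    (hsum : ∑ i, s i = w) (hw : 0 < w) :
    (Fintype.card ι : ℝ) * Real.log (Fintype.card ι) / 2 ≤
      ∑ i ∈ Finset.univ.filter (fun i => s i ≤ w / 2), Real.log (w / s i) := by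
  classical
  set k : ℝ := (Fintype.card ι : ℝ) with hk
  have hsw : ∀ i, s i ≤ w := fun i => by
    rw [← hsum]; exact Finset.single_le_sum (fun j _ => (hs j).le) (Finset.mem_univ i)
  have hnn : ∀ i, 0 ≤ Real.log (w / s i) := fun i =>
    Real.log_nonneg (by rw [le_div_iff₀ (hs i)]; linarith [hsw i])
  rcases Nat.lt_or_ge (Fintype.card ι) 2 with h2 | h2
  · have : Real.log k = 0 := by
      have : Fintype.card ι = 0 ∨ Fintype.card ι = 1 := by omega
      rcases this with h | h <;> simp [hk, h]
    rw [this]; simp only [mul_zero, zero_div]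
    exact Finset.sum_nonneg (fun i _ => hnn i)
  have hk2 : (2 : ℝ) ≤ k := by rw [hk]; exact_mod_cast h2
  have hlk : 0 ≤ Real.log k := Real.log_nonneg (by linarith)
  have key : ∀ i, Real.log k + 1 - k / w * s i ≤ Real.log (w / s i) := fun i => by
    have hx : 0 < s i * k / w := by have := hs i; positivity
    have h := Real.log_le_sub_one_of_pos hx
    rw [Real.log_div (by have := hs i; positivity) hw.ne',
      Real.log_mul (hs i).ne' (by positivity)] at h
    rw [Real.log_div hw.ne' (hs i).ne']
    have : s i * k / w = k / w * s i := by ring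
    linarith
  by_cases hb : ∃ i, w / 2 < s i
  · obtain ⟨b, hb⟩ := hb
    have hF : Finset.univ.filter (fun i => s i ≤ w / 2) = Finset.univ.erase b := by
      ext i
      simp only [Finset.mem_filter, Finset.mem_univ, true_and, Finset.mem_erase, and_true]
      constructor
      · rintro h rfl; linarith
      · intro hne
        have := Finset.sum_le_sum_of_subset_of_nonneg (Finset.subset_univ ({i, b} : Finset ι))
          (f := s) (fun j _ _ => (hs j).le)
        rw [Finset.sum_pair hne, hsum] at this
        linarith
    rw [hF]
    have h1 := Finset.sum_le_sum (fun i (_ : i ∈ Finset.univ.erase b) => key i)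
    have hse : ∑ i ∈ Finset.univ.erase b, s i = w - s b := by
      rw [← hsum, ← Finset.add_sum_erase _ s (Finset.mem_univ b)]; ring
    rw [Finset.sum_sub_distrib, ← Finset.mul_sum, hse, Finset.sum_const,
      Finset.card_erase_of_mem (Finset.mem_univ b), Finset.card_univ, nsmul_eq_mul,
      Nat.cast_sub (by omega), ← hk] at h1
    refine le_trans ?_ h1
    have : k / w * (w - s b) ≤ k / w * (w / 2) := by
      apply mul_le_mul_of_nonneg_left _ (by positivity); linarith
    have h3 : k / w * (w / 2) = k / 2 := by field_simp
    push_cast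
    nlinarith
  · push Not at hb
    have hF : Finset.univ.filter (fun i => s i ≤ w / 2) = Finset.univ := by
      ext i; simp [hb i]
    rw [hF]
    have h1 := Finset.sum_le_sum (fun i (_ : i ∈ Finset.univ) => key i)
    rw [Finset.sum_sub_distrib, ← Finset.mul_sum, hsum, Finset.sum_const,
      Finset.card_univ, nsmul_eq_mul, ← hk] at h1
    have h3 : k / w * w = k := by field_simp
    nlinarith

lemma step_card {V E : Type*} [Fintype V] {m : ℕ} (ends : E → V × V) (color : E → Fin m)
    (I : Finset (Fin m)) (c : Fin m) (X : Finset (colGraph ends color I).ConnectedComponent)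
    (hX : ∀ C ∈ X, ∃ A : Finset V, (∀ v, v ∈ A ↔ v ∈ C.supp) ∧ crosses ends color A c) :
    X.card + 2 * Nat.card (colGraph ends color (insert c I)).ConnectedComponent ≤
      2 * Nat.card (colGraph ends color I).ConnectedComponent := by
  classical
  have hle : colGraph ends color I ≤ colGraph ends color (insert c I) := by
    intro v u h
    simp only [colGraph, SimpleGraph.fromRel_adj] at h ⊢
    refine ⟨h.1, ?_⟩
    rcases h.2 with ⟨e, he, h2⟩ | ⟨e, he, h2⟩
    · exact Or.inl ⟨e, Finset.mem_insert_of_mem he, h2⟩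
    · exact Or.inr ⟨e, Finset.mem_insert_of_mem he, h2⟩
  have : Fintype (colGraph ends color I).ConnectedComponent := Fintype.ofFinite _
  have : Fintype (colGraph ends color (insert c I)).ConnectedComponent := Fintype.ofFinite _
  rw [Nat.card_eq_fintype_card, Nat.card_eq_fintype_card]
  apply fiber_bound (SimpleGraph.ConnectedComponent.map (SimpleGraph.Hom.ofLE hle))
  · intro D
    induction D using SimpleGraph.ConnectedComponent.ind with
    | _ v => exact ⟨(colGraph ends color I).connectedComponentMk v, rfl⟩
  · intro C hC
    obtain ⟨A, hA, e, hec, hcr⟩ := hX C hC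
    have main : ∀ v u, v ∈ A → u ∉ A → (ends e = (v, u) ∨ ends e = (u, v)) →
        ∃ a', a' ≠ C ∧ SimpleGraph.ConnectedComponent.map (SimpleGraph.Hom.ofLE hle) a' =
          SimpleGraph.ConnectedComponent.map (SimpleGraph.Hom.ofLE hle) C := by
      intro v u hv hu he
      have hne : v ≠ u := fun h => hu (h ▸ hv)
      rw [hA, SimpleGraph.ConnectedComponent.mem_supp_iff] at hv hu
      refine ⟨_, hu, ?_⟩
      rw [← hv]
      simp only [SimpleGraph.ConnectedComponent.map_mk]
      apply SimpleGraph.ConnectedComponent.sound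
      apply SimpleGraph.Adj.reachable
      simp only [colGraph, SimpleGraph.fromRel_adj]
      refine ⟨hne.symm, ?_⟩
      rcases he with he | he
      · exact Or.inr ⟨e, by simp [hec], he⟩
      · exact Or.inl ⟨e, by simp [hec], he⟩
    rcases hcr with ⟨h1, h2⟩ | ⟨h1, h2⟩
    · exact main _ _ h1 h2 (Or.inl rfl)
    · exact main _ _ h2 h1 (Or.inr rfl)

lemma not_cross_mem {V E : Type*} {m : ℕ} (ends : E → V × V) (color : E → Fin m)
    (I : Finset (Fin m)) (c : Fin m) (hc : c ∈ I)
    (C : (colGraph ends color I).ConnectedComponent) (A : Finset V)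
    (hA : ∀ v, v ∈ A ↔ v ∈ C.supp) : ¬ crosses ends color A c := by
  rintro ⟨e, hec, hcr⟩
  have hne : (ends e).1 ≠ (ends e).2 := by
    intro h; rw [h] at hcr; tauto
  have hadj : (colGraph ends color I).Adj (ends e).1 (ends e).2 := by
    simp only [colGraph, SimpleGraph.fromRel_adj]
    exact ⟨hne, Or.inl ⟨e, by rw [hec]; exact hc, rfl⟩⟩
  have := SimpleGraph.ConnectedComponent.sound hadj.reachable
  simp only [hA, SimpleGraph.ConnectedComponent.mem_supp_iff, this] at hcr
  tauto

lemma step_log {V : Type*} [Fintype V] [Nonempty V] {E : Type*} 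
    (m w : ℕ) (hw : 2 ≤ w) (hcard : Fintype.card V = w)
    (ends : E → V × V) (color : E → Fin m)
    (γ : ℝ) (hγ : 0 < γ)
    (hexp : ∀ A : Finset V, A.Nonempty → (A.card : ℝ) ≤ (w : ℝ) / 2 →
      γ * m * Real.log ((w : ℝ) / (A.card : ℝ)) ≤ (Nat.card {c : Fin m // crosses ends color A c} : ℝ))
    (I : Finset (Fin m)) :
    ∑ c ∈ Finset.univ \ I,
      Real.log (Nat.card (colGraph ends color (insert c I)).ConnectedComponent) ≤
    ((m : ℝ) - I.card) * Real.exp (-(γ / 4)) *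
      Real.log (Nat.card (colGraph ends color I).ConnectedComponent) := by
  classical
  set G := colGraph ends color I with hG
  have : Fintype G.ConnectedComponent := Fintype.ofFinite _
  let S : G.ConnectedComponent → Finset V := fun C => Finset.univ.filter (fun v => v ∈ C.supp)
  have hS : ∀ C v, v ∈ S C ↔ v ∈ C.supp := fun C v => by simp [S]
  set k : ℝ := (Nat.card G.ConnectedComponent : ℝ) with hk
  have hkc : k = (Fintype.card G.ConnectedComponent : ℝ) := by rw [hk, Nat.card_eq_fintype_card]
  have : Nonempty G.ConnectedComponent := ⟨G.connectedComponentMk (Classical.arbitrary V)⟩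
  have hk1 : 1 ≤ k := by rw [hkc]; exact_mod_cast Fintype.card_pos
  have hlk : 0 ≤ Real.log k := Real.log_nonneg hk1
  let X : Fin m → Finset G.ConnectedComponent :=
    fun c => Finset.univ.filter (fun C => crosses ends color (S C) c)
  -- single color step
  have h1 : ∀ c, Real.log (Nat.card (colGraph ends color (insert c I)).ConnectedComponent) ≤
      Real.log k - (X c).card / (2 * k) := by
    intro c
    have h := step_card ends color I c (X c) (fun C hC => ⟨S C, hS C, (Finset.mem_filter.mp hC).2⟩)
    have h' : ((X c).card : ℝ) + 2 * (Nat.card (colGraph ends color (insert c I)).ConnectedComponent : ℝ)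
        ≤ 2 * k := by rw [hk]; exact_mod_cast h
    have : Nonempty (colGraph ends color (insert c I)).ConnectedComponent :=
      ⟨(colGraph ends color (insert c I)).connectedComponentMk (Classical.arbitrary V)⟩
    have hpos : 0 < (Nat.card (colGraph ends color (insert c I)).ConnectedComponent : ℝ) := by
      exact_mod_cast Nat.card_pos
    set k' : ℝ := (Nat.card (colGraph ends color (insert c I)).ConnectedComponent : ℝ)
    have hl := Real.log_le_sub_one_of_pos (div_pos hpos (by linarith : 0 < k))
    rw [Real.log_div hpos.ne' (by linarith)] at hl
    have : k' / k ≤ 1 - (X c).card / (2 * k) := by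
      rw [div_le_iff₀ (by linarith), sub_mul]
      have : ((X c).card : ℝ) / (2 * k) * k = (X c).card / 2 := by field_simp
      rw [this]; linarith
    linarith
  -- double counting
  have h2 : ∑ c ∈ Finset.univ \ I, ((X c).card : ℝ) =
      ∑ C : G.ConnectedComponent, (Nat.card {c : Fin m // crosses ends color (S C) c} : ℝ) := by
    have e1 : ∑ c ∈ Finset.univ \ I, ((X c).card : ℝ) = ∑ c, ((X c).card : ℝ) := by
      apply Finset.sum_subset (Finset.subset_univ _)
      intro c _ hc
      have hc : c ∈ I := by simpa using hc
      have : X c = ∅ := by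
        apply Finset.filter_false_of_mem
        intro C _
        exact not_cross_mem ends color I c hc C (S C) (hS C)
      simp [this]
    rw [e1]
    simp only [X, Finset.card_filter, Nat.cast_sum]
    rw [Finset.sum_comm]
    apply Finset.sum_congr rfl
    intro C _
    rw [Nat.card_eq_fintype_card, Fintype.card_subtype, Finset.card_filter, Nat.cast_sum]
  have hSne : ∀ C, (S C).Nonempty := fun C => by
    obtain ⟨v, hv⟩ := C.nonempty_supp
    exact ⟨v, (hS C v).mpr hv⟩
  have hsum : ∑ C, ((S C).card : ℝ) = w := by
    rw [← hcard, ← Nat.cast_sum]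
    congr 1
    rw [← Finset.card_univ, Finset.card_eq_sum_card_fiberwise (f := G.connectedComponentMk)
      (t := Finset.univ) (fun _ _ => Finset.mem_univ _)]
    apply Finset.sum_congr rfl
    intro C _
    congr 1
    ext v
    simp [S]
  have h3 : γ * m * (k * Real.log k / 2) ≤ ∑ c ∈ Finset.univ \ I, ((X c).card : ℝ) := by
    rw [h2]
    have hsz := size_ineq (fun C => ((S C).card : ℝ)) w
      (fun C => by exact_mod_cast (hSne C).card_pos) hsum (by positivity)
    rw [← hkc] at hsz
    calc γ * m * (k * Real.log k / 2) ≤ γ * m * _ := mul_le_mul_of_nonneg_left hsz (by positivity)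
      _ = ∑ C ∈ Finset.univ.filter (fun C => ((S C).card : ℝ) ≤ (w : ℝ) / 2),
            γ * m * Real.log (w / (S C).card) := by rw [Finset.mul_sum]
      _ ≤ ∑ C ∈ Finset.univ.filter (fun C => ((S C).card : ℝ) ≤ (w : ℝ) / 2),
            (Nat.card {c : Fin m // crosses ends color (S C) c} : ℝ) :=
          Finset.sum_le_sum (fun C hC => hexp _ (hSne C) (Finset.mem_filter.mp hC).2)
      _ ≤ _ := Finset.sum_le_sum_of_subset_of_nonneg (Finset.subset_univ _)
          (fun _ _ _ => by positivity)
  have hcardI : ((Finset.univ \ I).card : ℝ) = (m : ℝ) - I.card := by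
    have := Finset.card_sdiff_add_card_eq_card (Finset.subset_univ I)
    rw [Finset.card_univ, Fintype.card_fin] at this
    have h' : ((Finset.univ \ I).card : ℝ) + I.card = m := by exact_mod_cast this
    linarith
  have hmI : 0 ≤ (m : ℝ) - I.card := by rw [← hcardI]; positivity
  calc _ ≤ ∑ c ∈ Finset.univ \ I, (Real.log k - (X c).card / (2 * k)) :=
        Finset.sum_le_sum (fun c _ => h1 c)
    _ = ((m : ℝ) - I.card) * Real.log k - (∑ c ∈ Finset.univ \ I, ((X c).card : ℝ)) / (2 * k) := by
        rw [Finset.sum_sub_distrib, Finset.sum_const, nsmul_eq_mul, hcardI, Finset.sum_div]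
    _ ≤ ((m : ℝ) - I.card) * Real.log k - γ * m * (k * Real.log k / 2) / (2 * k) := by
        gcongr
    _ = ((m : ℝ) - I.card) * Real.log k - γ / 4 * m * Real.log k := by
        field_simp; ring
    _ ≤ ((m : ℝ) - I.card) * (1 - γ / 4) * Real.log k := by
        have : 0 ≤ γ / 4 * I.card * Real.log k := by positivity
        linarith
    _ ≤ _ := by
        have := Real.add_one_le_exp (-(γ / 4))
        gcongr
        linarith

lemma sum_insert_count {m : ℕ} (f : Finset (Fin m) → ℝ) (t : ℕ) :
    ((t : ℝ) + 1) * ∑ J ∈ (Finset.univ : Finset (Fin m)).powersetCard (t + 1), f J =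
      ∑ I ∈ (Finset.univ : Finset (Fin m)).powersetCard t,
        ∑ c ∈ Finset.univ \ I, f (insert c I) := by
  have h : ((t : ℝ) + 1) * ∑ J ∈ (Finset.univ : Finset (Fin m)).powersetCard (t + 1), f J =
      ∑ J ∈ (Finset.univ : Finset (Fin m)).powersetCard (t + 1), ∑ c ∈ J, f J := by
    rw [Finset.mul_sum]
    apply Finset.sum_congr rfl
    intro J hJ
    rw [Finset.sum_const, (Finset.mem_powersetCard.mp hJ).2, nsmul_eq_mul]; push_cast; rfl
  rw [h, Finset.sum_sigma', Finset.sum_sigma']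
  refine Finset.sum_bij' (fun x _ => ⟨x.1.erase x.2, x.2⟩) (fun x _ => ⟨insert x.2 x.1, x.2⟩)
    ?_ ?_ ?_ ?_ ?_
  · rintro ⟨J, c⟩ h
    simp only [Finset.mem_sigma, Finset.mem_powersetCard, Finset.subset_univ, true_and] at h
    simp [Finset.mem_powersetCard, Finset.card_erase_of_mem h.2, h.1]
  · rintro ⟨J, c⟩ h
    simp only [Finset.mem_sigma, Finset.mem_powersetCard, Finset.subset_univ, true_and,
      Finset.mem_sdiff, Finset.mem_univ] at h
    simp [Finset.mem_powersetCard, Finset.card_insert_of_notMem h.2, h.1]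
  · rintro ⟨J, c⟩ h
    simp only [Finset.mem_sigma] at h
    simp [Finset.insert_erase h.2]
  · rintro ⟨J, c⟩ h
    simp only [Finset.mem_sigma, Finset.mem_sdiff, Finset.mem_univ, true_and] at h
    simp [Finset.erase_insert h.2]
  · rintro ⟨J, c⟩ h
    simp only [Finset.mem_sigma] at h
    simp [Finset.insert_erase h.2]

lemma iterate_bound {m : ℕ} (f : Finset (Fin m) → ℝ) (q L : ℝ) (hq : 0 ≤ q) (h0 : f ∅ ≤ L)
    (hf : ∀ I, ∑ c ∈ Finset.univ \ I, f (insert c I) ≤ ((m : ℝ) - I.card) * q * f I)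
    (t : ℕ) (ht : t ≤ m) :
    ∑ I ∈ (Finset.univ : Finset (Fin m)).powersetCard t, f I ≤ (m.choose t : ℝ) * q ^ t * L := by
  induction t with
  | zero => simpa using h0
  | succ t ih =>
    have ih := ih (by omega)
    have hmt : (0 : ℝ) ≤ (m : ℝ) - t := by
      have : (t : ℝ) ≤ m := by exact_mod_cast (by omega : t ≤ m)
      linarith
    have hch : (m.choose (t + 1) : ℝ) * (t + 1) = m.choose t * ((m : ℝ) - t) := by
      have := Nat.choose_succ_right_eq m t
      rw [← Nat.cast_sub (by omega : t ≤ m)]; exact_mod_cast this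
    have hpos : (0 : ℝ) < (t : ℝ) + 1 := by positivity
    refine le_of_mul_le_mul_left ?_ hpos
    rw [sum_insert_count]
    calc _ ≤ ∑ I ∈ (Finset.univ : Finset (Fin m)).powersetCard t, ((m : ℝ) - t) * q * f I := by
          apply Finset.sum_le_sum
          intro I hI
          have := hf I
          rwa [(Finset.mem_powersetCard.mp hI).2] at this
      _ = ((m : ℝ) - t) * q * ∑ I ∈ (Finset.univ : Finset (Fin m)).powersetCard t, f I := by
          rw [Finset.mul_sum]
      _ ≤ ((m : ℝ) - t) * q * ((m.choose t : ℝ) * q ^ t * L) := by gcongr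
      _ = (m.choose t * ((m : ℝ) - t)) * q ^ (t + 1) * L := by ring
      _ = _ := by rw [← hch]; ring


/-- Random colors give connectivity: in a loopless edge-colored multigraph on `w ≥ 2`
vertices with colors in `[m]` whose color classes are matchings, if every cut
`(A, V ∖ A)` with `|A| ≤ w/2` is crossed by at least `γ m log (w/|A|)` distinct colors,
then for `T ≥ (4/γ)(log log (4w) + log (1/η) + 1)` a uniformly random `T`-element set of
colors `I` makes `H[I]` connected with probability at least `1 - η`. -/
theorem stmt_5 {V : Type*} [Fintype V] {E : Type*} [Fintype E]
    (m w : ℕ) (hw : 2 ≤ w) (hcard : Fintype.card V = w)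
    (ends : E → V × V) (color : E → Fin m)
    (hloop : ∀ e, (ends e).1 ≠ (ends e).2)
    (hmatch : ∀ e e', e ≠ e' → color e = color e' →
      (ends e).1 ≠ (ends e').1 ∧ (ends e).1 ≠ (ends e').2 ∧
      (ends e).2 ≠ (ends e').1 ∧ (ends e).2 ≠ (ends e').2)
    (γ : ℝ) (hγ : 0 < γ)
    (hexp : ∀ A : Finset V, A.Nonempty → (A.card : ℝ) ≤ (w : ℝ) / 2 →
      γ * m * Real.log ((w : ℝ) / (A.card : ℝ)) ≤
        (Nat.card {c : Fin m // ∃ e, color e = c ∧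
          (((ends e).1 ∈ A ∧ (ends e).2 ∉ A) ∨ ((ends e).1 ∉ A ∧ (ends e).2 ∈ A))} : ℝ))
    (η : ℝ) (hη0 : 0 < η) (hη1 : η < 1)
    (T : ℕ) (hTm : T ≤ m)
    (hT : (4 / γ) * (Real.log (Real.log (4 * (w : ℝ))) + Real.log (1 / η) + 1) ≤ (T : ℝ)) :
    (1 - η) * (m.choose T : ℝ) ≤
      (Nat.card {I : Finset (Fin m) // I.card = T ∧
        (SimpleGraph.fromRel (fun v u : V => ∃ e, color e ∈ I ∧ ends e = (v, u))).Connected} : ℝ) := by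
  classical
  have : Nonempty V := Fintype.card_pos_iff.mp (by omega)
  let f : Finset (Fin m) → ℝ := fun I =>
    Real.log (Nat.card (colGraph ends color I).ConnectedComponent)
  have hw2 : (2 : ℝ) ≤ w := by exact_mod_cast hw
  have hcp : ∀ I, 1 ≤ Nat.card (colGraph ends color I).ConnectedComponent := fun I => by
    have : Nonempty (colGraph ends color I).ConnectedComponent :=
      ⟨(colGraph ends color I).connectedComponentMk (Classical.arbitrary V)⟩
    exact Nat.card_pos
  have hfnn : ∀ I, 0 ≤ f I := fun I => Real.log_nonneg (by exact_mod_cast hcp I)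
  have h0 : f ∅ ≤ Real.log w := by
    apply Real.log_le_log (by exact_mod_cast hcp ∅)
    have : Nat.card (colGraph ends color ∅).ConnectedComponent ≤ Nat.card V :=
      Nat.card_le_card_of_surjective (colGraph ends color ∅).connectedComponentMk
        (fun D => by
          induction D using SimpleGraph.ConnectedComponent.ind with
          | _ v => exact ⟨v, rfl⟩)
    rw [Nat.card_eq_fintype_card (α := V), hcard] at this
    exact_mod_cast this
  have hit := iterate_bound f (Real.exp (-(γ / 4))) (Real.log w) (Real.exp_pos _).le h0
    (fun I => step_log m w hw hcard ends color γ hγ hexp I) T hTm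
  set P := (Finset.univ : Finset (Fin m)).powersetCard T with hP
  have hPc : P.card = m.choose T := by simp [hP]
  let good : Finset (Fin m) → Prop := fun I => (colGraph ends color I).Connected
  have hgood : (Nat.card {I : Finset (Fin m) // I.card = T ∧
        (SimpleGraph.fromRel (fun v u : V => ∃ e, color e ∈ I ∧ ends e = (v, u))).Connected})
      = (P.filter good).card := by
    rw [Nat.card_eq_fintype_card, Fintype.card_subtype]
    congr 1
    ext I
    simp [hP, Finset.mem_powersetCard, good, colGraph]
  have hsplit : (P.filter good).card + (P.filter (fun I => ¬ good I)).card = m.choose T := by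
    rw [Finset.card_filter_add_card_filter_not, hPc]
  have hbad : ((P.filter (fun I => ¬ good I)).card : ℝ) * Real.log 2 ≤ ∑ I ∈ P, f I := by
    calc _ = ∑ I ∈ P.filter (fun I => ¬ good I), Real.log 2 := by
          rw [Finset.sum_const, nsmul_eq_mul]
      _ ≤ ∑ I ∈ P.filter (fun I => ¬ good I), f I := by
          apply Finset.sum_le_sum
          intro I hI
          have hng := (Finset.mem_filter.mp hI).2
          apply Real.log_le_log (by norm_num)
          have : 2 ≤ Nat.card (colGraph ends color I).ConnectedComponent := by
            by_contra hlt
            have h1 : Nat.card (colGraph ends color I).ConnectedComponent = 1 := by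
              have := hcp I; omega
            have := (Nat.card_eq_one_iff_unique.mp h1).1
            apply hng
            refine SimpleGraph.connected_iff _ |>.mpr ⟨fun u v => ?_, inferInstance⟩
            exact SimpleGraph.ConnectedComponent.exact (Subsingleton.elim _ _)
          exact_mod_cast this
      _ ≤ _ := Finset.sum_le_sum_of_subset_of_nonneg (Finset.filter_subset _ _)
          (fun I _ _ => hfnn I)
  -- numerics
  have hlw : 0 < Real.log w := Real.log_pos (by linarith)
  have hl4w : Real.log w ≤ Real.log (4 * w) := Real.log_le_log (by linarith) (by linarith)
  have hl4 : 0 < Real.log (4 * w) := by linarith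
  have hl2 : (0.6931471803 : ℝ) < Real.log 2 := Real.log_two_gt_d9
  have hq : Real.exp (-(γ / 4)) ^ T * Real.log w ≤ η * Real.log 2 := by
    have hT' : Real.log (Real.log (4 * w)) + Real.log (1 / η) + 1 ≤ γ / 4 * T := by
      have := mul_le_mul_of_nonneg_left hT (by positivity : 0 ≤ γ / 4)
      have e : γ / 4 * (4 / γ * (Real.log (Real.log (4 * (w : ℝ))) + Real.log (1 / η) + 1)) =
        Real.log (Real.log (4 * (w : ℝ))) + Real.log (1 / η) + 1 := by field_simp
      linarith
    have e1 : Real.exp (-(γ / 4)) ^ T ≤ η * Real.exp (-1) / Real.log (4 * w) := by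
      rw [← Real.exp_nat_mul]
      calc _ ≤ Real.exp (Real.log η + (-1) - Real.log (Real.log (4 * w))) := by
            apply Real.exp_le_exp.mpr
            rw [one_div, Real.log_inv] at hT'
            linarith
        _ = _ := by rw [Real.exp_sub, Real.exp_add, Real.exp_log hη0, Real.exp_log hl4]
    have e2 : Real.exp (-1) ≤ Real.log 2 := by
      have := Real.exp_neg_one_lt_d9
      linarith
    calc _ ≤ η * Real.exp (-1) / Real.log (4 * w) * Real.log (4 * w) := by gcongr
      _ = η * Real.exp (-1) := by field_simp
      _ ≤ _ := by gcongr
  have hfin : ((P.filter (fun I => ¬ good I)).card : ℝ) ≤ η * m.choose T := by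
    refine le_of_mul_le_mul_right ?_ (by linarith : 0 < Real.log 2)
    calc _ ≤ (m.choose T : ℝ) * Real.exp (-(γ / 4)) ^ T * Real.log w := hbad.trans hit
      _ = (m.choose T : ℝ) * (Real.exp (-(γ / 4)) ^ T * Real.log w) := by ring
      _ ≤ (m.choose T : ℝ) * (η * Real.log 2) := by gcongr
      _ = _ := by ring
  rw [hgood]
  have hs : ((P.filter good).card : ℝ) + ((P.filter (fun I => ¬ good I)).card : ℝ) = m.choose T := by
    exact_mod_cast hsplit
  linarith
end

section
/- Fix β > 0 and a positive integer d. There is a constant C = C(β,d) = O_β(d·log(2d)) such that for every integer b ≥ 2 the following holds: if G is a loopless edge-colored multigraph on b vertices with color set [m], every color class is a matching with at least β·b edges, and m ≥ C·Λ(b), then there exists a vertex set W ⊆ V(G) with |W| ≥ 2 and d spanning trees T₁, …, T_d of the induced subgraph G[W] whose color sets are pairwise disjoint. -/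
/-- `Λ(b) = max {1, log b · log log (4b)}` (natural logarithms). -/
noncomputable def Lam (b : ℝ) : ℝ := max 1 (Real.log b * Real.log (Real.log (4 * b)))

/-- `C` is a valid constant for the "large color matchings force color-disjoint spanning
trees" lemma with parameters `β` and `d`: for every loopless edge-colored multigraph on
`b ≥ 2` vertices with colors in `[m]`, whose color classes are matchings with at least
`β b` edges each, if `m ≥ C · Λ(b)` then some vertex set `W` with `|W| ≥ 2` carries `d`
spanning trees of the induced subgraph with pairwise disjoint color sets.  A spanning
tree of `G[W]` is given by a set of `|W| - 1` edges inside `W` connecting `W`. -/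
def MatchingsForceTrees (β : ℝ) (d : ℕ) (C : ℝ) : Prop :=
  ∀ (b m : ℕ), 2 ≤ b → C * Lam (b : ℝ) ≤ (m : ℝ) →
  ∀ (V E : Type) [Fintype V] [Fintype E],
    Fintype.card V = b →
    ∀ (ends : E → V × V) (color : E → Fin m),
      (∀ e, (ends e).1 ≠ (ends e).2) →
      (∀ e e', e ≠ e' → color e = color e' →
        (ends e).1 ≠ (ends e').1 ∧ (ends e).1 ≠ (ends e').2 ∧
        (ends e).2 ≠ (ends e').1 ∧ (ends e).2 ≠ (ends e').2) →
      (∀ c : Fin m, β * (b : ℝ) ≤ (Nat.card {e : E // color e = c} : ℝ)) →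
      ∃ W : Finset V, 2 ≤ W.card ∧
        ∃ F : Fin d → Finset E,
          (∀ r, ∀ e ∈ F r, (ends e).1 ∈ W ∧ (ends e).2 ∈ W) ∧
          (∀ r, (F r).card = W.card - 1) ∧
          (∀ r, (SimpleGraph.fromRel
            (fun v u : {x : V // x ∈ W} => ∃ e ∈ F r, ends e = (v.1, u.1))).Connected) ∧
          (Pairwise fun r r' : Fin d => Disjoint ((F r).image color) ((F r').image color))

/-! ### Random draws of colors -/

open Classical in
/-- Probability that `S` together with `n` independent uniform colors still fails. -/
noncomputable def PP {m : ℕ} (Fail : Finset (Fin m) → Prop) : ℕ → Finset (Fin m) → ℝ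
  | 0, S => if Fail S then 1 else 0
  | n + 1, S => (∑ c : Fin m, PP Fail n (insert c S)) / (m : ℝ)

theorem PP_nonneg {m : ℕ} (Fail : Finset (Fin m) → Prop) (n : ℕ) (S : Finset (Fin m)) :
    0 ≤ PP Fail n S := by
  induction n generalizing S with
  | zero => rw [PP]; split_ifs <;> norm_num
  | succ n ih =>
    rw [PP]
    exact div_nonneg (Finset.sum_nonneg fun c _ => ih _) (Nat.cast_nonneg _)

theorem PP_le_one {m : ℕ} (hm : 0 < m) (Fail : Finset (Fin m) → Prop) (n : ℕ)
    (S : Finset (Fin m)) : PP Fail n S ≤ 1 := by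
  have hm' : (0 : ℝ) < m := by exact_mod_cast hm
  induction n generalizing S with
  | zero => rw [PP]; split_ifs <;> norm_num
  | succ n ih =>
    rw [PP, div_le_one hm']
    calc _ ≤ ∑ c : Fin m, (1 : ℝ) := Finset.sum_le_sum fun c _ => ih _
      _ = m := by simp

theorem PP_anti {m : ℕ} (Fail : Finset (Fin m) → Prop)
    (hF : ∀ S S', S ⊆ S' → Fail S' → Fail S) (n : ℕ)
    (S S' : Finset (Fin m)) (h : S ⊆ S') : PP Fail n S' ≤ PP Fail n S := by
  induction n generalizing S S' with
  | zero =>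
    rw [PP, PP]
    by_cases h1 : Fail S'
    · rw [if_pos h1, if_pos (hF _ _ h h1)]
    · rw [if_neg h1]; split_ifs <;> norm_num
  | succ n ih =>
    rw [PP, PP]
    gcongr with c
    exact ih _ _ (Finset.insert_subset_insert c h)

theorem PP_zero_of_not {m : ℕ} (Fail : Finset (Fin m) → Prop)
    (hF : ∀ S S', S ⊆ S' → Fail S' → Fail S) (n : ℕ)
    (S : Finset (Fin m)) (h : ¬ Fail S) : PP Fail n S = 0 := by
  induction n generalizing S with
  | zero => rw [PP, if_neg h]
  | succ n ih =>
    rw [PP, Finset.sum_eq_zero, zero_div]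
    intro c _
    exact ih _ (fun h' => h (hF _ _ (Finset.subset_insert c S) h'))

theorem PP_markov {m : ℕ} (hm : 0 < m) (Fail : Finset (Fin m) → Prop)
    (hF : ∀ S S', S ⊆ S' → Fail S' → Fail S) (Ψ : Finset (Fin m) → ℝ) (h0 : ∀ S, 0 ≤ Ψ S)
    (hd : ∀ S, Fail S → (∑ c : Fin m, Ψ (insert c S)) / (m : ℝ) ≤ Ψ S - 1)
    (n : ℕ) (S : Finset (Fin m)) : n * PP Fail n S ≤ Ψ S := by
  have hm' : (0 : ℝ) < m := by exact_mod_cast hm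
  induction n generalizing S with
  | zero => simpa using h0 S
  | succ n ih =>
    by_cases hS : Fail S
    · have h1 : (n : ℝ) * PP Fail (n + 1) S ≤ (∑ c : Fin m, Ψ (insert c S)) / (m : ℝ) := by
        rw [PP, ← mul_div_assoc, Finset.mul_sum]
        gcongr with c
        exact ih _
      have h2 := PP_le_one hm Fail (n + 1) S
      have h3 := hd S hS
      push_cast
      linarith
    · rw [PP_zero_of_not Fail hF _ _ hS]; simpa using h0 S

theorem PP_restart {m : ℕ} (Fail : Finset (Fin m) → Prop)
    (hF : ∀ S S', S ⊆ S' → Fail S' → Fail S) (T : ℕ) (q : ℝ)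
    (hq : ∀ S, PP Fail T S ≤ q) (n : ℕ) (S : Finset (Fin m)) :
    PP Fail (n + T) S ≤ q * PP Fail n S := by
  induction n generalizing S with
  | zero =>
    by_cases hS : Fail S
    · rw [zero_add]
      have : PP Fail 0 S = 1 := by rw [PP, if_pos hS]
      rw [this, mul_one]; exact hq S
    · rw [PP_zero_of_not Fail hF _ _ hS, PP_zero_of_not Fail hF _ _ hS, mul_zero]
  | succ n ih =>
    rw [show n + 1 + T = (n + T) + 1 by omega, PP, PP, ← mul_div_assoc, Finset.mul_sum]
    gcongr with c
    exact ih _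

theorem PP_pow {m : ℕ} (hm : 0 < m) (Fail : Finset (Fin m) → Prop)
    (hF : ∀ S S', S ⊆ S' → Fail S' → Fail S) (T : ℕ) (q : ℝ) (hq0 : 0 ≤ q)
    (hq : ∀ S, PP Fail T S ≤ q) (j : ℕ) (S : Finset (Fin m)) :
    PP Fail (j * T) S ≤ q ^ j := by
  induction j with
  | zero => simpa using PP_le_one hm Fail _ S
  | succ j ih =>
    rw [Nat.succ_mul, pow_succ']
    exact (PP_restart Fail hF T q hq _ S).trans (mul_le_mul_of_nonneg_left ih hq0)

theorem PP_perm_step {m : ℕ} (hm : 0 < m) (Fail : Finset (Fin m) → Prop)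
    (hF : ∀ S S', S ⊆ S' → Fail S' → Fail S) (n : ℕ) (B : Finset (Fin m)) (x : Fin m)
    (hx : x ∉ B) :
    ∑ σ : Equiv.Perm (Fin m), PP Fail n ((insert x B).image σ) ≤
      ∑ σ : Equiv.Perm (Fin m), PP Fail (n + 1) (B.image σ) := by
  have hm' : (0 : ℝ) < m := by exact_mod_cast hm
  have key : ∀ y : Fin m, ∑ σ : Equiv.Perm (Fin m), PP Fail n ((insert x B).image σ) ≤
      ∑ σ : Equiv.Perm (Fin m), PP Fail n ((insert y B).image σ) := by
    intro y
    by_cases hy : y ∈ B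
    · apply Finset.sum_le_sum
      intro σ _
      apply PP_anti Fail hF
      rw [Finset.insert_eq_of_mem hy]
      exact Finset.image_subset_image (Finset.subset_insert _ _)
    · apply le_of_eq
      rw [← Equiv.sum_comp (Equiv.mulRight (Equiv.swap x y))
        (fun σ : Equiv.Perm (Fin m) => PP Fail n ((insert y B).image σ))]
      apply Finset.sum_congr rfl
      intro σ _
      congr 1
      have hB : B.image (fun z => σ (Equiv.swap x y z)) = B.image σ := by
        apply Finset.image_congr
        intro z hz
        have h1 : z ≠ x := fun h => hx (h ▸ hz)
        have h2 : z ≠ y := fun h => hy (h ▸ hz)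
        simp [Equiv.swap_apply_of_ne_of_ne h1 h2]
      have : (Equiv.mulRight (Equiv.swap x y) σ : Fin m → Fin m) =
          fun z => σ (Equiv.swap x y z) := by
        funext z; simp [Equiv.Perm.mul_apply]
      rw [this, Finset.image_insert, Finset.image_insert, hB]
      simp
  have h2 : ∑ σ : Equiv.Perm (Fin m), PP Fail (n + 1) (B.image σ) =
      (∑ y : Fin m, ∑ σ : Equiv.Perm (Fin m), PP Fail n ((insert y B).image σ)) / m := by
    rw [Finset.sum_comm, Finset.sum_div]
    apply Finset.sum_congr rfl
    intro σ _
    rw [PP]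
    congr 1
    rw [← Equiv.sum_comp σ]
    apply Finset.sum_congr rfl
    intro y _
    rw [Finset.image_insert]
  rw [h2, le_div_iff₀ hm']
  calc _ = ∑ y : Fin m, ∑ σ : Equiv.Perm (Fin m), PP Fail n ((insert x B).image σ) := by
        rw [Finset.sum_const]; simp [mul_comm]
    _ ≤ _ := Finset.sum_le_sum fun y _ => key y

theorem PP_perm {m : ℕ} (hm : 0 < m) (Fail : Finset (Fin m) → Prop)
    (hF : ∀ S S', S ⊆ S' → Fail S' → Fail S) (B : Finset (Fin m)) (n : ℕ) :
    ∑ σ : Equiv.Perm (Fin m), PP Fail n (B.image σ) ≤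
      (Fintype.card (Equiv.Perm (Fin m)) : ℝ) * PP Fail (n + B.card) ∅ := by
  induction B using Finset.induction_on generalizing n with
  | empty => simp
  | insert x B hx ih =>
    refine (PP_perm_step hm Fail hF n B x hx).trans ((ih (n + 1)).trans (le_of_eq ?_))
    rw [Finset.card_insert_of_notMem hx]
    congr 2
    omega

/-- Pairwise disjoint good color sets. -/
theorem exists_disjoint_good {m : ℕ} (hm : 0 < m) (Fail : Finset (Fin m) → Prop)
    (hF : ∀ S S', S ⊆ S' → Fail S' → Fail S) (d T : ℕ) (hdT : d * T ≤ m)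
    (hp : (d : ℝ) * PP Fail T ∅ < 1) :
    ∃ S : Fin d → Finset (Fin m), (∀ r, ¬ Fail (S r)) ∧
      Pairwise fun r r' => Disjoint (S r) (S r') := by
  let e : Fin d × Fin T → Fin m := fun p => Fin.castLE hdT (finProdFinEquiv p)
  have he : Function.Injective e := by
    intro p q h
    exact finProdFinEquiv.injective (Fin.castLE_injective hdT h)
  let B : Fin d → Finset (Fin m) := fun r => Finset.univ.image (fun t => e (r, t))
  have hB : ∀ r, (B r).card = T := by
    intro r
    rw [Finset.card_image_of_injective]
    · simp
    · intro t t' h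
      have := he h
      simpa using this
  have hdis : ∀ r r', r ≠ r' → Disjoint (B r) (B r') := by
    intro r r' hne
    rw [Finset.disjoint_left]
    intro x hx hx'
    obtain ⟨t, -, rfl⟩ := Finset.mem_image.1 hx
    obtain ⟨t', -, h⟩ := Finset.mem_image.1 hx'
    have := he h
    simp only [Prod.mk.injEq] at this
    exact hne this.1.symm
  have hN : (0 : ℝ) < (Fintype.card (Equiv.Perm (Fin m)) : ℝ) := by
    exact_mod_cast Fintype.card_pos
  have hsum : ∑ σ : Equiv.Perm (Fin m), ∑ r : Fin d, PP Fail 0 ((B r).image σ) <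
      ∑ σ : Equiv.Perm (Fin m), (1 : ℝ) := by
    rw [Finset.sum_comm]
    calc _ ≤ ∑ r : Fin d, (Fintype.card (Equiv.Perm (Fin m)) : ℝ) * PP Fail T ∅ := by
          apply Finset.sum_le_sum
          intro r _
          have := PP_perm hm Fail hF (B r) 0
          rwa [hB, zero_add] at this
      _ = (Fintype.card (Equiv.Perm (Fin m)) : ℝ) * ((d : ℝ) * PP Fail T ∅) := by
          simp; ring
      _ < (Fintype.card (Equiv.Perm (Fin m)) : ℝ) * 1 := by gcongr
      _ = _ := by simp
  obtain ⟨σ, -, hσ⟩ := Finset.exists_lt_of_sum_lt hsum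
  refine ⟨fun r => (B r).image σ, ?_, ?_⟩
  · intro r hr
    have h1 : PP Fail 0 ((B r).image σ) = 1 := by rw [PP, if_pos hr]
    have h2 := Finset.single_le_sum (f := fun r => PP Fail 0 ((B r).image σ))
      (fun i _ => PP_nonneg Fail 0 _) (Finset.mem_univ r)
    simp only [h1] at h2
    linarith
  · intro r r' hne
    exact (Finset.disjoint_image σ.injective).2 (hdis r r' hne)

/-! ### Merging lemma -/

theorem merge_card {α γ : Type*} [Fintype α] [Fintype γ] (f : α → γ)
    (hf : Function.Surjective f) (Hit : Finset α)
    (hH : ∀ a ∈ Hit, ∃ a', a' ≠ a ∧ f a' = f a) :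
    2 * Fintype.card γ + Hit.card ≤ 2 * Fintype.card α := by
  classical
  obtain ⟨g, hg⟩ := hf.hasRightInverse
  have hginj : Function.Injective g := hg.injective
  let R : Finset α := Finset.univ.image g
  have hR : R.card = Fintype.card γ := by
    rw [Finset.card_image_of_injective _ hginj]; rfl
  have hN : R.card + Rᶜ.card = Fintype.card α := Finset.card_add_card_compl R
  have h1 : (Hit ∩ R).card ≤ Rᶜ.card := by
    choose! p hp1 hp2 using hH
    refine Finset.card_le_card_of_injOn p ?_ ?_
    · intro a ha
      have ha := Finset.mem_inter.1 (Finset.mem_coe.1 ha)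
      obtain ⟨y, -, rfl⟩ := Finset.mem_image.1 ha.2
      have h1 := hp1 _ ha.1
      have h2 := hp2 _ ha.1
      simp only [Finset.coe_compl, Set.mem_compl_iff, Finset.mem_coe]
      intro h3
      obtain ⟨z, -, hz⟩ := Finset.mem_image.1 h3
      rw [← hz, hg z, hg y] at h2
      rw [← hz, h2] at h1
      exact h1 rfl
    · intro a ha a' ha' h
      have ha := Finset.mem_inter.1 (Finset.mem_coe.1 ha)
      have ha' := Finset.mem_inter.1 (Finset.mem_coe.1 ha')
      have h2 := hp2 _ ha.1
      have h2' := hp2 _ ha'.1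
      obtain ⟨y, -, rfl⟩ := Finset.mem_image.1 ha.2
      obtain ⟨z, -, rfl⟩ := Finset.mem_image.1 ha'.2
      rw [hg y] at h2
      rw [hg z] at h2'
      have : y = z := by rw [← h2, ← h2', h]
      rw [this]
  have h2 : (Hit \ R).card ≤ Rᶜ.card := by
    apply Finset.card_le_card
    intro a ha
    simp only [Finset.mem_sdiff] at ha
    simpa using ha.2
  have h3 : (Hit ∩ R).card + (Hit \ R).card = Hit.card := Finset.card_inter_add_card_sdiff Hit R
  omega

/-! ### The expander lemma -/

open Classical in
/-- Colors having an edge between `A` and `W \ A`. -/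
noncomputable def crossC {V E : Type} [Fintype E] {m : ℕ} (ends : E → V × V)
    (color : E → Fin m) (W A : Finset V) : Finset (Fin m) :=
  Finset.univ.filter fun c => ∃ e, color e = c ∧
    (((ends e).1 ∈ A ∧ (ends e).2 ∈ W ∧ (ends e).2 ∉ A) ∨
     ((ends e).2 ∈ A ∧ (ends e).1 ∈ W ∧ (ends e).1 ∉ A))

open Classical in
/-- Edges inside `X`. -/
noncomputable def insideE {V E : Type} [Fintype E] (ends : E → V × V) (X : Finset V) :
    Finset E :=
  Finset.univ.filter fun e => (ends e).1 ∈ X ∧ (ends e).2 ∈ X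

theorem inside_split {V E : Type} [Fintype E] [DecidableEq V] {m : ℕ} (ends : E → V × V)
    (color : E → Fin m)
    (hmat : ∀ e e', e ≠ e' → color e = color e' →
        (ends e).1 ≠ (ends e').1 ∧ (ends e).1 ≠ (ends e').2 ∧
        (ends e).2 ≠ (ends e').1 ∧ (ends e).2 ≠ (ends e').2)
    (W A : Finset V) :
    (insideE ends W).card ≤ (insideE ends A).card + (insideE ends (W \ A)).card
      + A.card * (crossC ends color W A).card := by
  classical
  let X : Finset E := Finset.univ.filter fun e =>
    (((ends e).1 ∈ A ∧ (ends e).2 ∈ W ∧ (ends e).2 ∉ A) ∨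
     ((ends e).2 ∈ A ∧ (ends e).1 ∈ W ∧ (ends e).1 ∉ A))
  have h1 : insideE ends W ⊆ (insideE ends A ∪ insideE ends (W \ A)) ∪ X := by
    intro e he
    simp only [insideE, Finset.mem_filter, Finset.mem_univ, true_and, Finset.mem_union,
      Finset.mem_sdiff, X] at he ⊢
    tauto
  have h2 : X.card ≤ A.card * (crossC ends color W A).card := by
    rw [← Finset.card_product]
    refine Finset.card_le_card_of_injOn
      (fun e => (if (ends e).1 ∈ A then (ends e).1 else (ends e).2, color e)) ?_ ?_
    · intro e he
      have he' : e ∈ X := he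
      simp only [X, Finset.mem_filter, Finset.mem_univ, true_and] at he'
      simp only [Finset.coe_product, Set.mem_prod, Finset.mem_coe]
      refine ⟨?_, ?_⟩
      · split_ifs with h
        · exact h
        · tauto
      · simp only [crossC, Finset.mem_filter, Finset.mem_univ, true_and]
        exact ⟨e, rfl, he'⟩
    · intro e he e' he' h
      simp only [Prod.mk.injEq] at h
      by_contra hne
      have := hmat e e' hne h.2
      obtain ⟨h, -⟩ := h
      split_ifs at h <;> tauto
  have h3 := Finset.card_le_card h1
  have h4 := Finset.card_union_le (insideE ends A ∪ insideE ends (W \ A)) X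
  have h5 := Finset.card_union_le (insideE ends A) (insideE ends (W \ A))
  omega

theorem expander {V E : Type} [Fintype V] [Fintype E] (β : ℝ) (hβ : 0 < β) (b m : ℕ)
    (hb : 2 ≤ b) (hm : 0 < m) (hV : Fintype.card V = b)
    (ends : E → V × V) (color : E → Fin m)
    (hloop : ∀ e, (ends e).1 ≠ (ends e).2)
    (hmat : ∀ e e', e ≠ e' → color e = color e' →
        (ends e).1 ≠ (ends e').1 ∧ (ends e).1 ≠ (ends e').2 ∧
        (ends e).2 ≠ (ends e').1 ∧ (ends e).2 ≠ (ends e').2)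
    (hcol : ∀ c : Fin m, β * (b : ℝ) ≤ (Nat.card {e : E // color e = c} : ℝ)) :
    ∃ W : Finset V, 2 ≤ W.card ∧ ∀ A ⊆ W, A.Nonempty →
      (m : ℝ) * (β / 2) * ((Real.log W.card - Real.log A.card) / Real.log b) ≤
        ((crossC ends color W A).card : ℝ) := by
  classical
  have hbR : (2 : ℝ) ≤ b := by exact_mod_cast hb
  have hmR : (0 : ℝ) < m := by exact_mod_cast hm
  have hlb : 0 < Real.log b := Real.log_pos (by linarith)
  -- g
  let g : ℕ → ℝ := fun x => 1 + Real.log x / Real.log b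
  have hg1 : ∀ x, 1 ≤ g x := by
    intro x
    have : 0 ≤ Real.log (x : ℝ) := Real.log_natCast_nonneg x
    have : 0 ≤ Real.log (x : ℝ) / Real.log b := by positivity
    simp only [g]; linarith
  have hgb : g b = 2 := by simp only [g]; rw [div_self hlb.ne']; norm_num
  -- total edges
  have htot : (m : ℝ) * (β * b) ≤ (Fintype.card E : ℝ) := by
    have : Fintype.card E = ∑ c : Fin m, Nat.card {e : E // color e = c} := by
      rw [← Finset.card_univ, Finset.card_eq_sum_card_fiberwise (f := color) (t := Finset.univ)
        (fun _ _ => Finset.mem_univ _)]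
      apply Finset.sum_congr rfl
      intro c _
      rw [Nat.card_eq_fintype_card, Fintype.card_subtype]
    rw [this]
    push_cast
    calc _ = ∑ c : Fin m, (β * b) := by simp
      _ ≤ _ := Finset.sum_le_sum fun c _ => hcol c
  have : Nonempty V := Fintype.card_pos_iff.1 (by omega)
  let φ : Finset V → ℝ := fun X => ((insideE ends X).card : ℝ) / (X.card * g X.card)
  obtain ⟨W, -, hW⟩ := Finset.exists_max_image (Finset.univ : Finset (Finset V)) φ
    Finset.univ_nonempty
  have hρ : (m : ℝ) * (β / 2) ≤ φ W := by
    refine le_trans ?_ (hW Finset.univ (Finset.mem_univ _))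
    have : (insideE ends (Finset.univ : Finset V)).card = Fintype.card E := by
      simp [insideE]
    simp only [φ]
    rw [this, Finset.card_univ, hV, hgb, le_div_iff₀ (by positivity)]
    linarith
  have hpos : 0 < φ W := lt_of_lt_of_le (by positivity) hρ
  have hWpos : 0 < (insideE ends W).card := by
    rcases Nat.eq_zero_or_pos (insideE ends W).card with h | h
    · simp only [φ, h] at hpos
      simp at hpos
    · exact h
  obtain ⟨e, he⟩ := Finset.card_pos.1 hWpos
  simp only [insideE, Finset.mem_filter, Finset.mem_univ, true_and] at he
  have hW2 : 2 ≤ W.card := Finset.one_lt_card.2 ⟨_, he.1, _, he.2, hloop e⟩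
  refine ⟨W, hW2, ?_⟩
  have hbound : ∀ X : Finset V, ((insideE ends X).card : ℝ) ≤ φ W * (X.card * g X.card) := by
    intro X
    rcases X.eq_empty_or_nonempty with rfl | hX
    · simp [insideE]
    · have h1 : (0 : ℝ) < X.card * g X.card := by
        have : (0 : ℝ) < X.card := by exact_mod_cast hX.card_pos
        have := hg1 X.card
        positivity
      rw [← div_le_iff₀ h1]
      exact hW X (Finset.mem_univ _)
  intro A hA hAne
  have hsplit := inside_split ends color hmat W A
  have hsplit' : ((insideE ends W).card : ℝ) ≤ (insideE ends A).card
      + (insideE ends (W \ A)).card + A.card * (crossC ends color W A).card := by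
    exact_mod_cast hsplit
  have hWeq : ((insideE ends W).card : ℝ) = φ W * (W.card * g W.card) := by
    have h1 : (0 : ℝ) < W.card * g W.card := by
      have : (0 : ℝ) < W.card := by exact_mod_cast (by omega : 0 < W.card)
      have := hg1 W.card
      positivity
    simp only [φ]
    rw [div_mul_cancel₀ _ h1.ne']
  have hcard : ((W \ A).card : ℝ) = W.card - A.card := by
    have := Finset.card_sdiff_add_card_eq_card hA
    rw [← this]; push_cast; ring
  have ha : (0 : ℝ) < A.card := by exact_mod_cast hAne.card_pos
  have hgm : ((W \ A).card : ℝ) * g (W \ A).card ≤ (W \ A).card * g W.card := by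
    rcases Nat.eq_zero_or_pos (W \ A).card with h | h
    · rw [h]; simp
    · have h' : (0 : ℝ) < (W \ A).card := by exact_mod_cast h
      have : ((W \ A).card : ℝ) ≤ W.card := by
        exact_mod_cast Finset.card_le_card Finset.sdiff_subset
      have h3 := Real.log_le_log h' this
      have h4 : g (W \ A).card ≤ g W.card :=
        add_le_add_right (div_le_div_of_nonneg_right h3 hlb.le) 1
      exact mul_le_mul_of_nonneg_left h4 h'.le
  have hA1 := hbound A
  have hA2 := (hbound (W \ A)).trans (mul_le_mul_of_nonneg_left hgm hpos.le)
  rw [hcard] at hA2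
  have hfin : A.card * (φ W * (g W.card - g A.card)) ≤
      A.card * ((crossC ends color W A).card : ℝ) := by
    have : φ W * (W.card * g W.card) - φ W * (A.card * g A.card)
      - φ W * ((W.card - A.card) * g W.card) = A.card * (φ W * (g W.card - g A.card)) := by ring
    linarith
  have hfin2 := le_of_mul_le_mul_left hfin ha
  have hgd : g W.card - g A.card = (Real.log W.card - Real.log A.card) / Real.log b := by
    simp only [g]; ring
  rw [hgd] at hfin2
  refine le_trans ?_ hfin2
  apply mul_le_mul_of_nonneg_right hρ
  apply div_nonneg _ hlb.le
  have : (A.card : ℝ) ≤ W.card := by exact_mod_cast Finset.card_le_card hA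
  have := Real.log_le_log ha this
  linarith

/-! ### Components -/

/-- The graph on `W` formed by the edges with colors in `S`. -/
def HG {V E : Type} {m : ℕ} (ends : E → V × V) (color : E → Fin m) (W : Finset V)
    (S : Finset (Fin m)) : SimpleGraph {x : V // x ∈ W} :=
  SimpleGraph.fromRel (fun v u : {x : V // x ∈ W} => ∃ e, color e ∈ S ∧ ends e = (v.1, u.1))

theorem HG_mono {V E : Type} {m : ℕ} (ends : E → V × V) (color : E → Fin m) (W : Finset V)
    {S S' : Finset (Fin m)} (h : S ⊆ S') : HG ends color W S ≤ HG ends color W S' := by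
  intro v u hvu
  simp only [HG, SimpleGraph.fromRel_adj] at hvu ⊢
  refine ⟨hvu.1, ?_⟩
  rcases hvu.2 with ⟨e, h1, h2⟩ | ⟨e, h1, h2⟩
  · exact Or.inl ⟨e, h h1, h2⟩
  · exact Or.inr ⟨e, h h1, h2⟩

/-- Number of components. -/
noncomputable def KK {V E : Type} {m : ℕ} (ends : E → V × V) (color : E → Fin m)
    (W : Finset V) (S : Finset (Fin m)) : ℕ :=
  Nat.card (HG ends color W S).ConnectedComponent

theorem KK_le {V E : Type} {m : ℕ} (ends : E → V × V) (color : E → Fin m)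
    (W : Finset V) (S : Finset (Fin m)) : KK ends color W S ≤ W.card := by
  have h := Nat.card_le_card_of_surjective (HG ends color W S).connectedComponentMk
    (fun C => C.exists_rep)
  simpa [KK] using h

theorem KK_pos {V E : Type} {m : ℕ} (ends : E → V × V) (color : E → Fin m)
    (W : Finset V) (hW : W.Nonempty) (S : Finset (Fin m)) : 1 ≤ KK ends color W S := by
  obtain ⟨x, hx⟩ := hW
  have : Nonempty (HG ends color W S).ConnectedComponent :=
    ⟨(HG ends color W S).connectedComponentMk ⟨x, hx⟩⟩
  exact Nat.card_pos

theorem KK_two {V E : Type} {m : ℕ} (ends : E → V × V) (color : E → Fin m)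
    (W : Finset V) (hW : W.Nonempty) (S : Finset (Fin m))
    (hS : ¬ (HG ends color W S).Connected) : 2 ≤ KK ends color W S := by
  by_contra hlt
  apply hS
  have h1 : Nat.card (HG ends color W S).ConnectedComponent ≤ 1 := by
    simp only [KK] at hlt; omega
  obtain ⟨x, hx⟩ := hW
  have hsub := Finite.card_le_one_iff_subsingleton.1 h1
  haveI : Nonempty {x : V // x ∈ W} := ⟨⟨x, hx⟩⟩
  refine ⟨fun u v => ?_⟩
  exact SimpleGraph.ConnectedComponent.exact (hsub.elim _ _)

open Classical in
/-- Vertex set of a component, as a set of vertices of the whole graph. -/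
noncomputable def compF {V : Type} {W : Finset V} {H : SimpleGraph {x : V // x ∈ W}}
    (C : H.ConnectedComponent) : Finset V :=
  W.filter (fun x => ∃ h : x ∈ W, H.connectedComponentMk ⟨x, h⟩ = C)

theorem compF_mem {V : Type} {W : Finset V} {H : SimpleGraph {x : V // x ∈ W}}
    (C : H.ConnectedComponent) (x : V) :
    x ∈ compF C ↔ ∃ h : x ∈ W, H.connectedComponentMk ⟨x, h⟩ = C := by
  simp only [compF, Finset.mem_filter]
  constructor
  · exact fun h => h.2
  · exact fun h => ⟨h.1, h⟩

theorem compF_sum {V : Type} {W : Finset V} {H : SimpleGraph {x : V // x ∈ W}}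
    [Fintype H.ConnectedComponent] :
    ∑ C : H.ConnectedComponent, (compF C).card = W.card := by
  classical
  rw [← Finset.card_biUnion]
  · congr 1
    ext x
    simp only [Finset.mem_biUnion, Finset.mem_univ, true_and, compF_mem]
    constructor
    · rintro ⟨C, h, -⟩; exact h
    · intro h; exact ⟨_, h, rfl⟩
  · intro C _ C' _ hne
    rw [Function.onFun, Finset.disjoint_left]
    intro x hx hx'
    rw [compF_mem] at hx hx'
    obtain ⟨h, h1⟩ := hx
    obtain ⟨h', h2⟩ := hx'
    exact hne (h1.symm.trans h2)

theorem compF_nonempty {V : Type} {W : Finset V} {H : SimpleGraph {x : V // x ∈ W}}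
    (C : H.ConnectedComponent) : (compF C).Nonempty := by
  obtain ⟨⟨x, hx⟩, h⟩ := C.exists_rep
  exact ⟨x, (compF_mem C x).2 ⟨hx, h⟩⟩

open Classical in
theorem KK_insert {V E : Type} [Fintype E] {m : ℕ} (ends : E → V × V) (color : E → Fin m)
    (W : Finset V) (S : Finset (Fin m)) (c : Fin m)
    [Fintype (HG ends color W S).ConnectedComponent] :
    2 * KK ends color W (insert c S) +
      (Finset.univ.filter (fun C : (HG ends color W S).ConnectedComponent =>
        c ∈ crossC ends color W (compF C))).card ≤ 2 * KK ends color W S := by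
  have hle := HG_mono ends color W (Finset.subset_insert c S)
  haveI : Fintype (HG ends color W (insert c S)).ConnectedComponent := Fintype.ofFinite _
  have := merge_card (SimpleGraph.ConnectedComponent.map (SimpleGraph.Hom.ofLE hle)) ?_
    (Finset.univ.filter (fun C : (HG ends color W S).ConnectedComponent =>
        c ∈ crossC ends color W (compF C))) ?_
  · simpa only [KK, Nat.card_eq_fintype_card] using this
  · intro C
    obtain ⟨x, rfl⟩ := C.exists_rep
    exact ⟨(HG ends color W S).connectedComponentMk x, rfl⟩
  · intro C hC
    simp only [crossC, Finset.mem_filter, Finset.mem_univ, true_and] at hC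
    have main : ∀ x y : V, x ∈ compF C → ∀ hy : y ∈ W, y ∉ compF C →
        (∀ (hx : x ∈ W), (HG ends color W (insert c S)).Adj ⟨x, hx⟩ ⟨y, hy⟩) →
        ∃ a', a' ≠ C ∧ SimpleGraph.ConnectedComponent.map (SimpleGraph.Hom.ofLE hle) a' =
          SimpleGraph.ConnectedComponent.map (SimpleGraph.Hom.ofLE hle) C := by
      intro x y hx hy hyC hadj
      obtain ⟨hxW, hxC⟩ := (compF_mem C x).1 hx
      refine ⟨(HG ends color W S).connectedComponentMk ⟨y, hy⟩, ?_, ?_⟩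
      · intro h
        exact hyC ((compF_mem C y).2 ⟨hy, h⟩)
      · rw [← hxC]
        exact SimpleGraph.ConnectedComponent.sound (hadj hxW).symm.reachable
    obtain ⟨e, hec, he⟩ := hC
    have hes : color e ∈ insert c S := by rw [hec]; exact Finset.mem_insert_self _ _
    rcases he with ⟨h1, h2, h3⟩ | ⟨h1, h2, h3⟩
    · refine main _ _ h1 h2 h3 ?_
      intro hx
      simp only [HG, SimpleGraph.fromRel_adj]
      refine ⟨?_, Or.inl ⟨e, hes, rfl⟩⟩
      intro h
      have := congrArg Subtype.val h
      simp only at this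
      exact h3 (this ▸ h1)
    · refine main _ _ h1 h2 h3 ?_
      intro hx
      simp only [HG, SimpleGraph.fromRel_adj]
      refine ⟨?_, Or.inr ⟨e, hes, rfl⟩⟩
      intro h
      have := congrArg Subtype.val h
      simp only at this
      exact h3 (this ▸ h1)

theorem sum_log {ι : Type*} [Fintype ι] (a : ι → ℝ) (ha : ∀ i, 0 < a i) (w : ℝ) (hw : 0 < w)
    (hs : ∑ i, a i = w) (k : ℝ) (hk : (Fintype.card ι : ℝ) = k) (hk0 : 0 < k) :
    k * Real.log k ≤ ∑ i, (Real.log w - Real.log (a i)) := by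
  have h1 : ∀ i, Real.log k + (1 - k * a i / w) ≤ Real.log w - Real.log (a i) := by
    intro i
    have hp : 0 < k * a i / w := div_pos (mul_pos hk0 (ha i)) hw
    have := Real.log_le_sub_one_of_pos hp
    rw [Real.log_div (mul_pos hk0 (ha i)).ne' hw.ne', Real.log_mul hk0.ne' (ha i).ne'] at this
    linarith
  calc k * Real.log k = ∑ i, (Real.log k + (1 - k * a i / w)) := by
        rw [Finset.sum_add_distrib, Finset.sum_sub_distrib, ← Finset.sum_div, ← Finset.mul_sum, hs]
        simp only [Finset.sum_const, Finset.card_univ, nsmul_eq_mul, hk]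
        field_simp
        ring
    _ ≤ _ := Finset.sum_le_sum fun i _ => h1 i

theorem KK_drift {V E : Type} [Fintype E] {m : ℕ} (ends : E → V × V) (color : E → Fin m)
    (W : Finset V) (hW : W.Nonempty) (S : Finset (Fin m)) (q : ℝ) (hq : 0 ≤ q)
    (hexp : ∀ A ⊆ W, A.Nonempty → q * (Real.log W.card - Real.log A.card) ≤
        ((crossC ends color W A).card : ℝ)) :
    2 * ∑ c : Fin m, (KK ends color W (insert c S) : ℝ) +
      q * (KK ends color W S * Real.log (KK ends color W S)) ≤
      2 * (m * KK ends color W S) := by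
  classical
  haveI : Fintype (HG ends color W S).ConnectedComponent := Fintype.ofFinite _
  have hKpos : (0 : ℝ) < KK ends color W S := by
    exact_mod_cast KK_pos ends color W hW S
  have h1 := sum_log (fun C : (HG ends color W S).ConnectedComponent => ((compF C).card : ℝ))
    (fun C => by exact_mod_cast (compF_nonempty C).card_pos) (W.card : ℝ)
    (by exact_mod_cast hW.card_pos) (by exact_mod_cast compF_sum) (KK ends color W S)
    (by simp [KK, Nat.card_eq_fintype_card]) hKpos
  have h2 : q * (KK ends color W S * Real.log (KK ends color W S)) ≤
      ∑ C : (HG ends color W S).ConnectedComponent,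
        ((crossC ends color W (compF C)).card : ℝ) := by
    refine (mul_le_mul_of_nonneg_left h1 hq).trans ?_
    rw [Finset.mul_sum]
    apply Finset.sum_le_sum
    intro C _
    exact hexp _ (Finset.filter_subset _ _) (compF_nonempty C)
  have h3 : ∑ C : (HG ends color W S).ConnectedComponent,
        (crossC ends color W (compF C)).card =
      ∑ c : Fin m, (Finset.univ.filter (fun C : (HG ends color W S).ConnectedComponent =>
        c ∈ crossC ends color W (compF C))).card := by
    have := Finset.sum_card_bipartiteAbove_eq_sum_card_bipartiteBelow
      (s := (Finset.univ : Finset (HG ends color W S).ConnectedComponent))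
      (t := (Finset.univ : Finset (Fin m)))
      (fun C c => c ∈ crossC ends color W (compF C))
    simpa [Finset.bipartiteAbove, Finset.bipartiteBelow] using this
  have h4 : ∑ c : Fin m, (2 * KK ends color W (insert c S) +
      (Finset.univ.filter (fun C : (HG ends color W S).ConnectedComponent =>
        c ∈ crossC ends color W (compF C))).card) ≤ ∑ c : Fin m, 2 * KK ends color W S :=
    Finset.sum_le_sum fun c _ => KK_insert ends color W S c
  rw [Finset.sum_add_distrib, ← h3, ← Finset.mul_sum] at h4
  simp only [Finset.sum_const, Finset.card_univ, Fintype.card_fin, smul_eq_mul] at h4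
  have h5 : (2 : ℝ) * ∑ c : Fin m, (KK ends color W (insert c S) : ℝ) +
      ∑ C : (HG ends color W S).ConnectedComponent,
        ((crossC ends color W (compF C)).card : ℝ) ≤ m * (2 * KK ends color W S) := by
    exact_mod_cast h4
  linarith

theorem loglog_ineq (k k' : ℝ) (hk : 1 ≤ k) (hk' : 1 ≤ k') :
    Real.log (1 + Real.log k') ≤ Real.log (1 + Real.log k) + (k' / k - 1) / (1 + Real.log k) := by
  have h0 := Real.log_nonneg hk
  have h0' := Real.log_nonneg hk'
  have h1 : Real.log k' - Real.log k ≤ k' / k - 1 := by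
    rw [← Real.log_div (by positivity) (by positivity)]
    exact Real.log_le_sub_one_of_pos (by positivity)
  have h2 : Real.log (1 + Real.log k') - Real.log (1 + Real.log k) ≤
      (1 + Real.log k') / (1 + Real.log k) - 1 := by
    rw [← Real.log_div (by positivity) (by positivity)]
    exact Real.log_le_sub_one_of_pos (by positivity)
  have h3 : (1 + Real.log k') / (1 + Real.log k) - 1 =
      (Real.log k' - Real.log k) / (1 + Real.log k) := by
    field_simp; ring
  have h4 : (Real.log k' - Real.log k) / (1 + Real.log k) ≤ (k' / k - 1) / (1 + Real.log k) := by
    gcongr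
  linarith

theorem Psi_drift {V E : Type} [Fintype E] {m : ℕ} (hm : 0 < m) (ends : E → V × V)
    (color : E → Fin m)
    (W : Finset V) (hW : W.Nonempty) (S : Finset (Fin m)) (q : ℝ) (hq : 0 < q)
    (hexp : ∀ A ⊆ W, A.Nonempty → (m * q) * (Real.log W.card - Real.log A.card) ≤
        ((crossC ends color W A).card : ℝ))
    (hS : ¬ (HG ends color W S).Connected) :
    (∑ c : Fin m, (6 / q) * Real.log (1 + Real.log (KK ends color W (insert c S)))) / (m : ℝ) ≤
      (6 / q) * Real.log (1 + Real.log (KK ends color W S)) - 1 := by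
  have hm' : (0 : ℝ) < m := by exact_mod_cast hm
  have hdr := KK_drift ends color W hW S (m * q) (by positivity) hexp
  have hk2 : (2 : ℝ) ≤ KK ends color W S := by exact_mod_cast KK_two ends color W hW S hS
  have hk1 : ∀ c, (1 : ℝ) ≤ KK ends color W (insert c S) := fun c => by
    exact_mod_cast KK_pos ends color W hW (insert c S)
  generalize (KK ends color W S : ℝ) = k at *
  have hlk : 0.69 ≤ Real.log k := by
    have := Real.log_le_log (by norm_num) hk2
    have := Real.log_two_gt_d9
    linarith
  have hsum : ∑ c : Fin m, ((KK ends color W (insert c S) : ℝ) / k - 1) ≤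
      - (m * q / 2 * Real.log k) := by
    rw [Finset.sum_sub_distrib, ← Finset.sum_div]
    simp only [Finset.sum_const, Finset.card_univ, Fintype.card_fin, nsmul_eq_mul, mul_one]
    rw [sub_le_iff_le_add, div_le_iff₀ (by linarith)]
    linarith
  have hc : ∀ c : Fin m, (6 / q) * Real.log (1 + Real.log (KK ends color W (insert c S))) ≤
      (6 / q) * Real.log (1 + Real.log k) +
        (6 / q) / (1 + Real.log k) * ((KK ends color W (insert c S) : ℝ) / k - 1) := by
    intro c
    have := mul_le_mul_of_nonneg_left
      (loglog_ineq k (KK ends color W (insert c S)) (by linarith) (hk1 c))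
      (by positivity : 0 ≤ 6 / q)
    refine this.trans (le_of_eq ?_)
    ring
  rw [div_le_iff₀ hm']
  refine (Finset.sum_le_sum fun c _ => hc c).trans ?_
  rw [Finset.sum_add_distrib, ← Finset.mul_sum, ← Finset.mul_sum]
  simp only [Finset.sum_const, Finset.card_univ, Fintype.card_fin, nsmul_eq_mul]
  have h1 : (6 / q) / (1 + Real.log k) *
      ∑ c : Fin m, ((KK ends color W (insert c S) : ℝ) / k - 1) ≤
      (6 / q) / (1 + Real.log k) * (- (m * q / 2 * Real.log k)) :=
    mul_le_mul_of_nonneg_left hsum (by positivity)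
  have h2 : (6 / q) / (1 + Real.log k) * (- (m * q / 2 * Real.log k)) =
      - (m * (3 * Real.log k / (1 + Real.log k))) := by
    field_simp; ring
  have h3 : 1 ≤ 3 * Real.log k / (1 + Real.log k) := by
    rw [le_div_iff₀ (by linarith)]; linarith
  have h4 : (m : ℝ) * 1 ≤ m * (3 * Real.log k / (1 + Real.log k)) :=
    mul_le_mul_of_nonneg_left h3 hm'.le
  linarith

/-- A spanning tree with colors in `S`. -/
theorem exists_tree {V E : Type} [Fintype E] {m : ℕ} (ends : E → V × V)
    (color : E → Fin m) (W : Finset V) (S : Finset (Fin m))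
    (hS : (HG ends color W S).Connected) :
    ∃ F : Finset E, (∀ e ∈ F, (ends e).1 ∈ W ∧ (ends e).2 ∈ W) ∧ F.card = W.card - 1 ∧
      (SimpleGraph.fromRel
        (fun v u : {x : V // x ∈ W} => ∃ e ∈ F, ends e = (v.1, u.1))).Connected ∧
      ∀ e ∈ F, color e ∈ S := by
  classical
  obtain ⟨T, hT, hTree⟩ := hS.exists_isTree_le
  have hcard := hTree.card_edgeFinset
  have hch : ∀ s : Sym2 {x : V // x ∈ W}, s ∈ T.edgeFinset →
      ∃ e : E, color e ∈ S ∧ (∃ u v : {x : V // x ∈ W}, ends e = (u.1, v.1) ∧ s = s(u, v)) := by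
    intro s
    induction s using Sym2.ind with
    | _ u v =>
      intro h
      rw [SimpleGraph.mem_edgeFinset, SimpleGraph.mem_edgeSet] at h
      have h' := hT h
      simp only [HG, SimpleGraph.fromRel_adj] at h'
      rcases h'.2 with ⟨e, h1, h2⟩ | ⟨e, h1, h2⟩
      · exact ⟨e, h1, u, v, h2, rfl⟩
      · exact ⟨e, h1, v, u, h2, Sym2.eq_swap⟩
  have hne : Nonempty E ∨ T.edgeFinset = ∅ := by
    rcases T.edgeFinset.eq_empty_or_nonempty with h | ⟨s, hs⟩
    · exact Or.inr h
    · exact Or.inl ⟨(hch s hs).choose⟩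
  let f : {s // s ∈ T.edgeFinset} → E := fun s => (hch s.1 s.2).choose
  have hf1 : ∀ s, color (f s) ∈ S := fun s => (hch s.1 s.2).choose_spec.1
  have hf2 : ∀ s, ∃ u v : {x : V // x ∈ W}, ends (f s) = (u.1, v.1) ∧ s.1 = s(u, v) :=
    fun s => (hch s.1 s.2).choose_spec.2
  have hinj : Function.Injective f := by
    intro s s' h
    obtain ⟨u, v, h1, h2⟩ := hf2 s
    obtain ⟨u', v', h1', h2'⟩ := hf2 s'
    rw [h, h1'] at h1
    simp only [Prod.mk.injEq] at h1
    apply Subtype.ext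
    rw [h2, h2', Subtype.ext h1.1, Subtype.ext h1.2]
  refine ⟨Finset.univ.image f, ?_, ?_, ?_, ?_⟩
  · intro e he
    obtain ⟨s, -, rfl⟩ := Finset.mem_image.1 he
    obtain ⟨u, v, h1, -⟩ := hf2 s
    rw [h1]
    exact ⟨u.2, v.2⟩
  · rw [Finset.card_image_of_injective _ hinj, Finset.card_univ, Fintype.card_coe]
    rw [Fintype.card_coe] at hcard
    omega
  · refine hTree.connected.mono ?_
    intro u v huv
    simp only [SimpleGraph.fromRel_adj]
    refine ⟨huv.ne, ?_⟩
    have hm : s(u, v) ∈ T.edgeFinset := by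
      rw [SimpleGraph.mem_edgeFinset, SimpleGraph.mem_edgeSet]; exact huv
    obtain ⟨u', v', h1, h2⟩ := hf2 ⟨s(u, v), hm⟩
    have hmem : f ⟨s(u, v), hm⟩ ∈ Finset.univ.image f :=
      Finset.mem_image_of_mem _ (Finset.mem_univ _)
    simp only [Sym2.eq_iff] at h2
    rcases h2 with ⟨rfl, rfl⟩ | ⟨rfl, rfl⟩
    · exact Or.inl ⟨_, hmem, h1⟩
    · exact Or.inr ⟨_, hmem, h1⟩
  · intro e he
    obtain ⟨s, -, rfl⟩ := Finset.mem_image.1 he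
    exact hf1 s

/-- Large color matchings force `d` color-disjoint spanning trees, with a constant
`C(β, d) = O_β(d log (2d))`. -/
theorem stmt_6 (β : ℝ) (hβ : 0 < β) :
    ∃ Kβ : ℝ, 0 < Kβ ∧ ∀ d : ℕ, 1 ≤ d →
      ∃ C : ℝ, 0 < C ∧ C ≤ Kβ * (d : ℝ) * Real.log (2 * (d : ℝ)) ∧
        MatchingsForceTrees β d C := by
  have hK : 0 < 2 * (24 / β + 1) := by positivity
  refine ⟨2 * (24 / β + 1), hK, ?_⟩
  intro d hd
  have hdR : (1 : ℝ) ≤ d := by exact_mod_cast hd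
  have hl2 := Real.log_two_gt_d9
  have hlogd : 0 < Real.log (2 * (d : ℝ)) := Real.log_pos (by linarith)
  refine ⟨2 * (24 / β + 1) * d * Real.log (2 * d), by positivity, le_rfl, ?_⟩
  intro b m hb hm V E _ _ hV ends color hloop hmat hcol
  have hL1 : 1 ≤ Lam (b : ℝ) := le_max_left _ _
  have hL2 : Real.log b * Real.log (Real.log (4 * b)) ≤ Lam (b : ℝ) := le_max_right _ _
  generalize Lam (b : ℝ) = L at *
  have hbR : (2 : ℝ) ≤ b := by exact_mod_cast hb
  have hlb : 0 < Real.log b := Real.log_pos (by linarith)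
  have hm' : (0 : ℝ) < m := lt_of_lt_of_le (by positivity) hm
  have hm0 : 0 < m := by exact_mod_cast hm'
  obtain ⟨W, hW2, hexp⟩ := expander β hβ b m hb hm0 hV ends color hloop hmat hcol
  have hWne : W.Nonempty := Finset.card_pos.1 (by omega)
  set q : ℝ := β / (2 * Real.log b) with hq
  have hq0 : 0 < q := by positivity
  have hexp' : ∀ A ⊆ W, A.Nonempty → (m * q) * (Real.log W.card - Real.log A.card) ≤
      ((crossC ends color W A).card : ℝ) := by
    intro A hA hAne
    refine le_trans (le_of_eq ?_) (hexp A hA hAne)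
    rw [hq]; field_simp
  let Fail : Finset (Fin m) → Prop := fun S => ¬ (HG ends color W S).Connected
  have hF : ∀ S S', S ⊆ S' → Fail S' → Fail S := by
    intro S S' h h1 h2
    exact h1 (h2.mono (HG_mono ends color W h))
  let Ψ : Finset (Fin m) → ℝ := fun S =>
    (6 / q) * Real.log (1 + Real.log (KK ends color W S))
  have hΨ0 : ∀ S, 0 ≤ Ψ S := by
    intro S
    have h1 : 0 ≤ Real.log (KK ends color W S : ℝ) := Real.log_natCast_nonneg _
    have h2 : 0 ≤ Real.log (1 + Real.log (KK ends color W S : ℝ)) :=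
      Real.log_nonneg (by linarith)
    have : 0 ≤ 6 / q := by positivity
    exact mul_nonneg this h2
  have hΨL : ∀ S, Ψ S ≤ 12 / β * L := by
    intro S
    have h1 : (1 : ℝ) ≤ KK ends color W S := by exact_mod_cast KK_pos ends color W hWne S
    have h2 : (KK ends color W S : ℝ) ≤ b := by
      have h3 := KK_le ends color W S
      have h4 := Finset.card_le_univ W
      rw [hV] at h4
      exact_mod_cast h3.trans h4
    have h3 := Real.log_nonneg h1
    have h4 := Real.log_le_log (by linarith) h2
    have h5 : Real.log (4 * (b : ℝ)) = 2 * Real.log 2 + Real.log b := by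
      rw [Real.log_mul (by norm_num) (by positivity), show (4 : ℝ) = 2 ^ 2 by norm_num,
        Real.log_pow]
      norm_num
    have h6 : Real.log (1 + Real.log (KK ends color W S : ℝ)) ≤
        Real.log (Real.log (4 * b)) := by
      apply Real.log_le_log (by linarith)
      rw [h5]; linarith
    have h7 : 6 / q = 12 / β * Real.log b := by
      rw [hq]; field_simp; norm_num
    calc Ψ S ≤ 6 / q * Real.log (Real.log (4 * b)) :=
          mul_le_mul_of_nonneg_left h6 (by positivity)
      _ = 12 / β * (Real.log b * Real.log (Real.log (4 * b))) := by rw [h7]; ring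
      _ ≤ _ := mul_le_mul_of_nonneg_left hL2 (by positivity)
  set T0 : ℕ := ⌈24 / β * L⌉₊ with hT0
  have hT0a : 24 / β * L ≤ T0 := Nat.le_ceil _
  have hT0b : (T0 : ℝ) ≤ (24 / β + 1) * L := by
    have := (Nat.ceil_lt_add_one (by positivity : 0 ≤ 24 / β * L)).le
    rw [← hT0] at this
    linarith
  have hT0p : (0 : ℝ) < T0 := lt_of_lt_of_le (by positivity) hT0a
  have hhalf : ∀ S, PP Fail T0 S ≤ 1 / 2 := by
    intro S
    have h1 := PP_markov hm0 Fail hF Ψ hΨ0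
      (fun S hS => Psi_drift hm0 ends color W hWne S q hq0 hexp' hS) T0 S
    have h2 : (T0 : ℝ) * PP Fail T0 S ≤ T0 * (1 / 2) := by
      have h3 := hΨL S
      have h4 : 12 / β * L = (24 / β * L) * (1 / 2) := by ring
      linarith
    exact le_of_mul_le_mul_left h2 hT0p
  set j : ℕ := Nat.log 2 d + 1 with hj
  have hj1 : d < 2 ^ j := Nat.lt_pow_succ_log_self (by norm_num) d
  have hj2 : 2 ^ j ≤ 2 * d := by
    rw [hj, pow_succ']
    exact Nat.mul_le_mul_left 2 (Nat.pow_log_le_self 2 (by omega))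
  have hj3 : (j : ℝ) ≤ 2 * Real.log (2 * d) := by
    have h1 : ((2 : ℝ) ^ j) ≤ 2 * d := by exact_mod_cast hj2
    have h2 := Real.log_le_log (by positivity) h1
    rw [Real.log_pow] at h2
    have h3 : (j : ℝ) * (1 / 2) ≤ j * Real.log 2 :=
      mul_le_mul_of_nonneg_left (by linarith) (Nat.cast_nonneg _)
    linarith
  have hdT : d * (j * T0) ≤ m := by
    have h1 : (d : ℝ) * (j * T0) ≤ d * ((2 * Real.log (2 * d)) * ((24 / β + 1) * L)) := by
      gcongr
    have h2 : (d : ℝ) * ((2 * Real.log (2 * d)) * ((24 / β + 1) * L)) =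
      2 * (24 / β + 1) * d * Real.log (2 * d) * L := by ring
    have h3 : (d : ℝ) * (j * T0) ≤ m := by linarith
    exact_mod_cast h3
  have hp : (d : ℝ) * PP Fail (j * T0) ∅ < 1 := by
    have h1 := PP_pow hm0 Fail hF T0 (1 / 2) (by norm_num) hhalf j ∅
    have h2 : (d : ℝ) < 2 ^ j := by exact_mod_cast hj1
    calc (d : ℝ) * PP Fail (j * T0) ∅ ≤ d * (1 / 2) ^ j := by gcongr
      _ < 2 ^ j * (1 / 2) ^ j := by gcongr
      _ = 1 := by rw [← mul_pow]; norm_num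
  obtain ⟨S, hS, hdisj⟩ := exists_disjoint_good hm0 Fail hF d (j * T0) hdT hp
  have hS' : ∀ r, (HG ends color W (S r)).Connected := fun r => not_not.1 (hS r)
  choose F hF1 hF2 hF3 hF4 using fun r => exists_tree ends color W (S r) (hS' r)
  refine ⟨W, hW2, F, hF1, hF2, hF3, ?_⟩
  intro r r' hne
  refine Finset.disjoint_of_subset_left ?_ (Finset.disjoint_of_subset_right ?_ (hdisj hne))
  · exact Finset.image_subset_iff.2 (hF4 r)
  · exact Finset.image_subset_iff.2 (hF4 r')
end

section
/- Let α, ε ∈ (0,1), d ∈ ℤ⁺. There exist δ > 0, n₀ = O_{α,ε}(d log d), and a computable f : ℤ⁺ → ℤ⁺ such that for every n ≥ n₀ and prime p ≥ f(n), a uniformly random d-dimensional linear code C ⊆ 𝔽_p^n is, with probability at least 1 − ε, (α, ℓ, ((1+ε)/(1−α))·ℓ)-list recoverable simultaneously for all positive integers ℓ ≤ 2^{δ·n/log n}. -/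
/-- A code `C ⊆ 𝔽_p^n` is `(α, ℓ, L)`-list recoverable if for all lists
`S₁, …, S_n ⊆ 𝔽_p` of size `ℓ`, at most `L` codewords `x ∈ C` satisfy
`|{i : x_i ∉ S_i}| ≤ α n`. -/
def ListRecoverable {p n : ℕ} (C : Set (Fin n → ZMod p)) (α : ℝ) (ℓ : ℕ) (L : ℝ) : Prop :=
  ∀ S : Fin n → Finset (ZMod p), (∀ i, (S i).card = ℓ) →
    (Nat.card {x : Fin n → ZMod p // x ∈ C ∧
      (Nat.card {i : Fin n // x i ∉ S i} : ℝ) ≤ α * (n : ℝ)} : ℝ) ≤ L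


namespace LR
open Finset

lemma surj_count {Q Q' : Type*} [Fintype Q] [Fintype Q'] [DecidableEq Q] [DecidableEq Q'] (g : Q → Q')
    (hg : Function.Surjective g) (U : Finset Q) (hU : ∀ q ∈ U, ∃ q', q' ≠ q ∧ g q' = g q) :
    2 * Fintype.card Q' + U.card ≤ 2 * Fintype.card Q := by
  have h1 : Fintype.card Q = ∑ b : Q', (univ.filter (fun q => g q = b)).card :=
    Finset.card_eq_sum_card_fiberwise (f := g) (s := univ) (t := univ) (by intro x _; simp)
  have h2 : U.card = ∑ b : Q', (U.filter (fun q => g q = b)).card :=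
    Finset.card_eq_sum_card_fiberwise (f := g) (s := U) (t := univ) (by intro x _; simp)
  have h3 : 2 * Fintype.card Q' = ∑ b : Q', 2 := by simp [mul_comm]
  rw [h3, h2, h1, ← Finset.sum_add_distrib, Finset.mul_sum]
  apply Finset.sum_le_sum
  intro b _
  have hsub : U.filter (fun q => g q = b) ⊆ univ.filter (fun q => g q = b) := by
    intro q; simp
  have hle := Finset.card_le_card hsub
  have hpos : 0 < (univ.filter (fun q => g q = b)).card := by
    obtain ⟨q, hq⟩ := hg b
    exact Finset.card_pos.mpr ⟨q, by simp [hq]⟩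
  by_cases hem : (U.filter (fun q => g q = b)) = ∅
  · rw [hem, Finset.card_empty]; omega
  · obtain ⟨q, hq⟩ := Finset.nonempty_iff_ne_empty.mpr hem
    simp only [Finset.mem_filter] at hq
    obtain ⟨q', hne, hq'⟩ := hU q hq.1
    have : 1 < (univ.filter (fun q => g q = b)).card :=
      Finset.one_lt_card.mpr ⟨q, by simp [hq.2], q', by simp [hq', hq.2], hne.symm⟩
    omega

/-- the partition of `V` generated by the fibres of the maps `c i`, `i ∈ A` -/
def comp {ι V β : Type*} (c : ι → V → β) (A : Finset ι) : Setoid V := ⨆ i ∈ A, Setoid.ker (c i)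

/-- number of components -/
noncomputable def ncomp {ι V β : Type*} (c : ι → V → β) (A : Finset ι) : ℕ :=
  Nat.card (Quotient (comp c A))

lemma comp_rel {ι V β : Type*} (c : ι → V → β) (A : Finset ι) {i : ι} (hi : i ∈ A) {x y : V}
    (h : c i x = c i y) : (comp c A) x y := by
  have : Setoid.ker (c i) ≤ comp c A := le_iSup₂ (f := fun i (_ : i ∈ A) => Setoid.ker (c i)) i hi
  exact this h

lemma comp_mono {ι V β : Type*} (c : ι → V → β) {A B : Finset ι} (h : A ⊆ B) :
    comp c A ≤ comp c B := by
  apply iSup₂_le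
  intro i hi
  exact le_iSup₂ (f := fun i (_ : i ∈ B) => Setoid.ker (c i)) i (h hi)

open Classical in
/-- members of a class -/
noncomputable def cls {ι V β : Type*} [Fintype V] (c : ι → V → β) (A : Finset ι)
    (q : Quotient (comp c A)) : Finset V := univ.filter (fun x => (Quotient.mk _ x) = q)

/-- colour `i` leaves `S` -/
def crosses {ι V β : Type*} (c : ι → V → β) (i : ι) (S : Finset V) : Prop :=
  ∃ x ∈ S, ∃ y, y ∉ S ∧ c i x = c i y

open Classical in
lemma ncomp_insert {ι V β : Type*} [DecidableEq ι] [Fintype V] (c : ι → V → β) (A : Finset ι) (i : ι) :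
    2 * ncomp c (insert i A) +
      (univ.filter (fun q : Quotient (comp c A) => crosses c i (cls c A q))).card
      ≤ 2 * ncomp c A := by
  unfold ncomp
  rw [Nat.card_eq_fintype_card, Nat.card_eq_fintype_card]
  have hle : comp c A ≤ comp c (insert i A) := comp_mono c (Finset.subset_insert i A)
  apply surj_count (Quotient.map' (s₁ := comp c A) (s₂ := comp c (insert i A)) id (fun x y h => hle h))
  · intro b
    induction b using Quotient.inductionOn with
    | h x => exact ⟨Quotient.mk _ x, rfl⟩
  · intro q hq
    simp only [Finset.mem_filter, Finset.mem_univ, true_and] at hq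
    obtain ⟨x, hx, y, hy, hxy⟩ := hq
    simp only [cls, Finset.mem_filter, Finset.mem_univ, true_and] at hx hy
    refine ⟨Quotient.mk _ y, hy, ?_⟩
    rw [← hx]
    apply Quotient.sound
    exact comp_rel c _ (Finset.mem_insert_self i A) hxy.symm

open Classical in
lemma cross_count {ι V β : Type*} [Fintype ι] [Fintype V] (c : ι → V → β) (S : Finset V) :
    ∑ i, ((S.image (c i)) ∩ (Sᶜ.image (c i))).card ≤
      S.card * (univ.filter (fun i => crosses c i S)).card := by
  rw [Finset.card_filter, Finset.mul_sum]
  apply Finset.sum_le_sum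
  intro i _
  by_cases h : crosses c i S
  · simp only [h, if_true, mul_one]
    exact (Finset.card_le_card Finset.inter_subset_left).trans Finset.card_image_le
  · simp only [h, if_false, mul_zero, Nat.le_zero, Finset.card_eq_zero]
    rw [Finset.eq_empty_iff_forall_notMem]
    intro b hb
    simp only [Finset.mem_inter, Finset.mem_image, Finset.mem_compl] at hb
    obtain ⟨⟨x, hx, hxb⟩, y, hy, hyb⟩ := hb
    exact h ⟨x, hx, y, hy, hxb.trans hyb.symm⟩

open Classical in
lemma gain_sum {ι V β : Type*} [Fintype ι] [DecidableEq ι] [Fintype V] [Nonempty V] (c : ι → V → β) (L : ℝ)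
    (hL : 0 ≤ L)
    (hcut : ∀ S : Finset V, S.Nonempty →
      L * (S.card * Real.log (Fintype.card V / S.card)) ≤
        ((∑ i, ((S.image (c i)) ∩ (Sᶜ.image (c i))).card : ℕ) : ℝ)) (A : Finset ι) :
    L * (ncomp c A * Real.log (ncomp c A)) ≤
      ∑ i, 2 * ((ncomp c A : ℝ) - ncomp c (insert i A)) := by
  set m := ncomp c A with hm
  have hmc : m = Fintype.card (Quotient (comp c A)) := by
    rw [hm]; unfold ncomp; rw [Nat.card_eq_fintype_card]
  have : Nonempty (Quotient (comp c A)) := ⟨Quotient.mk _ (Classical.arbitrary V)⟩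
  have hmpos : 0 < m := by rw [hmc]; exact Fintype.card_pos
  have hN : (0:ℝ) < Fintype.card V := by exact_mod_cast Fintype.card_pos
  have hmR : (0:ℝ) < m := by exact_mod_cast hmpos
  have hne : ∀ q, (cls c A q).Nonempty := by
    intro q
    induction q using Quotient.inductionOn with
    | h x => exact ⟨x, by simp [cls]⟩
  have hr : ∀ q, L * Real.log (Fintype.card V / (cls c A q).card) ≤
      ((univ.filter (fun i => crosses c i (cls c A q))).card : ℝ) := by
    intro q
    have h1 := hcut _ (hne q)
    have h2 : ((∑ i, (((cls c A q).image (c i)) ∩ ((cls c A q)ᶜ.image (c i))).card : ℕ) : ℝ) ≤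
      (((cls c A q).card * (univ.filter (fun i => crosses c i (cls c A q))).card : ℕ) : ℝ) := by
      exact_mod_cast cross_count c (cls c A q)
    have hs : (0:ℝ) < (cls c A q).card := by exact_mod_cast (hne q).card_pos
    push_cast at h2
    push_cast at h1
    have h3 := h1.trans h2
    have h4 : ((cls c A q).card : ℝ) * (L * Real.log (Fintype.card V / (cls c A q).card)) ≤
      (cls c A q).card * (univ.filter (fun i => crosses c i (cls c A q))).card := by
      linarith
    exact le_of_mul_le_mul_left h4 hs
  have hlog : ∀ q, Real.log m + 1 - m * (cls c A q).card / Fintype.card V ≤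
      Real.log (Fintype.card V / (cls c A q).card) := by
    intro q
    have hs : (0:ℝ) < (cls c A q).card := by exact_mod_cast (hne q).card_pos
    have h := Real.log_le_sub_one_of_pos (x := m * (cls c A q).card / Fintype.card V) (by positivity)
    rw [Real.log_div (by positivity) (by positivity), Real.log_mul (by positivity) (by positivity)] at h
    rw [Real.log_div (by positivity) (by positivity)]
    linarith
  have hsum : ∑ q, ((cls c A q).card : ℝ) = Fintype.card V := by
    have := Finset.card_eq_sum_card_fiberwise (f := fun x : V => (Quotient.mk (comp c A) x))
      (s := univ) (t := univ) (by intro x _; simp)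
    rw [← Finset.card_univ, this]
    push_cast
    rfl
  have hJ : m * Real.log m ≤ ∑ q, Real.log (Fintype.card V / (cls c A q).card) := by
    calc m * Real.log m = ∑ q, (Real.log m + 1 - m * (cls c A q).card / Fintype.card V) := by
          rw [Finset.sum_sub_distrib, ← Finset.sum_div, ← Finset.mul_sum, hsum]
          rw [Finset.sum_const, Finset.card_univ, ← hmc, nsmul_eq_mul]
          field_simp
          ring
      _ ≤ _ := Finset.sum_le_sum (fun q _ => hlog q)
  have hdc : ∑ q : Quotient (comp c A), ((univ.filter (fun i => crosses c i (cls c A q))).card : ℝ) =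
      ∑ i, ((univ.filter (fun q : Quotient (comp c A) => crosses c i (cls c A q))).card : ℝ) := by
    simp only [Finset.card_filter]
    push_cast
    rw [Finset.sum_comm]
  calc L * (m * Real.log m) ≤ L * ∑ q, Real.log (Fintype.card V / (cls c A q).card) := by gcongr
    _ ≤ ∑ q : Quotient (comp c A), ((univ.filter (fun i => crosses c i (cls c A q))).card : ℝ) := by
        rw [Finset.mul_sum]; exact Finset.sum_le_sum (fun q _ => hr q)
    _ = _ := hdc
    _ ≤ _ := by
        apply Finset.sum_le_sum
        intro i _
        have h : ((2 * ncomp c (insert i A) +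
          (univ.filter (fun q : Quotient (comp c A) => crosses c i (cls c A q))).card : ℕ) : ℝ)
            ≤ ((2 * ncomp c A : ℕ) : ℝ) := by exact_mod_cast ncomp_insert c A i
        push_cast at h
        rw [← hm] at h
        linarith

/-- average number of components over permutations -/
noncomputable def avg {ι V β : Type*} [Fintype ι] [DecidableEq ι] (c : ι → V → β) (S : Finset ι) : ℝ :=
  (∑ σ : Equiv.Perm ι, (ncomp c (S.image σ) : ℝ)) / Fintype.card (Equiv.Perm ι)

lemma ncomp_pos {ι V β : Type*} [Fintype V] [Nonempty V] (c : ι → V → β) (A : Finset ι) :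
    0 < ncomp c A := by
  classical
  unfold ncomp
  have : Nonempty (Quotient (comp c A)) := ⟨Quotient.mk _ (Classical.arbitrary V)⟩
  rw [Nat.card_eq_fintype_card]
  exact Fintype.card_pos

lemma ncomp_le {ι V β : Type*} [Fintype V] (c : ι → V → β) (A : Finset ι) :
    ncomp c A ≤ Fintype.card V := by
  classical
  unfold ncomp
  rw [Nat.card_eq_fintype_card]
  exact Fintype.card_quotient_le _

lemma avg_ge_one {ι V β : Type*} [Fintype ι] [DecidableEq ι] [Fintype V] [Nonempty V]
    (c : ι → V → β) (S : Finset ι) : 1 ≤ avg c S := by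
  unfold avg
  rw [le_div_iff₀ (by exact_mod_cast Fintype.card_pos)]
  rw [one_mul, ← Finset.card_univ, Finset.card_eq_sum_ones]
  push_cast
  exact Finset.sum_le_sum (fun σ _ => by exact_mod_cast ncomp_pos c _)

lemma avg_step {ι V β : Type*} [Fintype ι] [DecidableEq ι] [Nonempty ι] [Fintype V] [Nonempty V]
    (c : ι → V → β) (L : ℝ)
    (hL : 0 ≤ L)
    (hg : ∀ A : Finset ι, L * (ncomp c A * Real.log (ncomp c A)) ≤
      ∑ i, 2 * ((ncomp c A : ℝ) - ncomp c (insert i A))) (S : Finset ι) (s : ι) (hs : s ∉ S) :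
    avg c (insert s S) ≤ avg c S - L / (2 * Fintype.card ι) * (avg c S * Real.log (avg c S)) := by
  set P : ℝ := ((Fintype.card (Equiv.Perm ι) : ℕ) : ℝ) with hP
  have hPpos : 0 < P := by rw [hP]; exact_mod_cast Fintype.card_pos
  have hn : (0:ℝ) < Fintype.card ι := by exact_mod_cast Fintype.card_pos
  set G : ι → ℝ := fun s' => ∑ σ : Equiv.Perm ι,
    ((ncomp c (S.image σ) : ℝ) - ncomp c (insert (σ s') (S.image σ))) with hG
  have hGs : G s = P * (avg c S - avg c (insert s S)) := by
    simp only [hG, avg, ← hP, Finset.sum_sub_distrib, Finset.image_insert]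
    field_simp
  have hGnn : 0 ≤ G s := by
    apply Finset.sum_nonneg
    intro σ _
    have := ncomp_insert c (S.image σ) (σ s)
    have : ncomp c (insert (σ s) (S.image σ)) ≤ ncomp c (S.image σ) := by omega
    have : (ncomp c (insert (σ s) (S.image σ)) : ℝ) ≤ ncomp c (S.image σ) := by exact_mod_cast this
    linarith
  have hGle : ∀ s', G s' ≤ G s := by
    intro s'
    by_cases h : s' ∈ S
    · have : G s' = 0 := by
        apply Finset.sum_eq_zero
        intro σ _
        rw [Finset.insert_eq_of_mem (Finset.mem_image_of_mem σ h)]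
        simp
      linarith
    · apply le_of_eq
      simp only [hG]
      apply Fintype.sum_equiv (Equiv.mulRight (Equiv.swap s s'))
      intro σ
      have h1 : S.image (⇑(σ * Equiv.swap s s')) = S.image σ := by
        apply Finset.image_congr
        intro x hx
        have hx' : x ∈ S := hx
        have hxs : x ≠ s := fun e => hs (e ▸ hx')
        have hxs' : x ≠ s' := fun e => h (e ▸ hx')
        simp [Equiv.swap_apply_of_ne_of_ne hxs hxs']
      simp only [Equiv.coe_mulRight, h1]
      simp
  have hsumG : ∑ s', G s' = ∑ σ : Equiv.Perm ι, ∑ i,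
      ((ncomp c (S.image σ) : ℝ) - ncomp c (insert i (S.image σ))) := by
    simp only [hG]
    rw [Finset.sum_comm]
    apply Finset.sum_congr rfl
    intro σ _
    exact Equiv.sum_comp σ (fun i => ((ncomp c (S.image σ) : ℝ) - ncomp c (insert i (S.image σ))))
  set M := avg c S with hM
  have hM1 : 1 ≤ M := avg_ge_one c S
  have hJ : P * (M * Real.log M) ≤ ∑ σ : Equiv.Perm ι,
      ((ncomp c (S.image σ) : ℝ) * Real.log (ncomp c (S.image σ))) := by
    have : ∑ σ : Equiv.Perm ι, ((ncomp c (S.image σ) : ℝ) * (Real.log M + 1) - M) = P * (M * Real.log M) := by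
      rw [Finset.sum_sub_distrib, ← Finset.sum_mul]
      have : ∑ σ : Equiv.Perm ι, (ncomp c (S.image σ) : ℝ) = P * M := by
        rw [hM, avg, ← hP]; field_simp
      rw [this, Finset.sum_const, Finset.card_univ, nsmul_eq_mul, ← hP]
      ring
    rw [← this]
    apply Finset.sum_le_sum
    intro σ _
    set m : ℝ := (ncomp c (S.image σ) : ℝ) with hm
    have hmpos : 0 < m := by rw [hm]; exact_mod_cast ncomp_pos c _
    have h := Real.log_le_sub_one_of_pos (x := M / m) (by positivity)
    rw [Real.log_div (by positivity) (by positivity)] at h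
    have h2 : m * (Real.log M - Real.log m) ≤ m * (M / m - 1) := by gcongr
    have h3 : m * (M / m - 1) = M - m := by field_simp
    linarith
  have hfin : L * (P * (M * Real.log M)) ≤ 2 * (Fintype.card ι * G s) := by
    calc L * (P * (M * Real.log M)) ≤ L * ∑ σ : Equiv.Perm ι,
      ((ncomp c (S.image σ) : ℝ) * Real.log (ncomp c (S.image σ))) := by gcongr
      _ ≤ ∑ σ : Equiv.Perm ι, ∑ i, 2 * ((ncomp c (S.image σ) : ℝ) - ncomp c (insert i (S.image σ))) := by
        rw [Finset.mul_sum]; exact Finset.sum_le_sum (fun σ _ => hg _)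
      _ = 2 * ∑ s', G s' := by
        rw [hsumG, Finset.mul_sum]
        simp only [Finset.mul_sum]
      _ ≤ 2 * ∑ s' : ι, G s := by gcongr with s' _; exact hGle s'
      _ = _ := by rw [Finset.sum_const, Finset.card_univ, nsmul_eq_mul]
  rw [hGs] at hfin
  have : L * (M * Real.log M) ≤ 2 * (Fintype.card ι * (M - avg c (insert s S))) := by
    have h : P * (L * (M * Real.log M)) ≤ P * (2 * (Fintype.card ι * (M - avg c (insert s S)))) := by
      linarith
    exact le_of_mul_le_mul_left h hPpos
  have h2 : L / (2 * Fintype.card ι) * (M * Real.log M) ≤ M - avg c (insert s S) := by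
    rw [div_mul_eq_mul_div, div_le_iff₀ (by positivity)]
    linarith
  linarith

lemma log_avg {ι V β : Type*} [Fintype ι] [DecidableEq ι] [Nonempty ι] [Fintype V] [Nonempty V]
    (c : ι → V → β) (L : ℝ)
    (hL : 0 ≤ L)
    (hg : ∀ A : Finset ι, L * (ncomp c A * Real.log (ncomp c A)) ≤
      ∑ i, 2 * ((ncomp c A : ℝ) - ncomp c (insert i A))) (S : Finset ι) :
    Real.log (avg c S) ≤ Real.exp (-(L / (2 * Fintype.card ι)) * S.card) * Real.log (Fintype.card V) := by
  induction S using Finset.induction_on with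
  | empty =>
    simp only [Finset.card_empty, Nat.cast_zero, mul_zero, Real.exp_zero, one_mul]
    apply Real.log_le_log (by linarith [avg_ge_one c (∅ : Finset ι)])
    unfold avg
    rw [div_le_iff₀ (by exact_mod_cast Fintype.card_pos)]
    calc _ ≤ ∑ σ : Equiv.Perm ι, (Fintype.card V : ℝ) :=
          Finset.sum_le_sum (fun σ _ => by exact_mod_cast ncomp_le c _)
      _ = _ := by rw [Finset.sum_const, Finset.card_univ, nsmul_eq_mul, mul_comm]
  | insert s S hs ih =>
    have h := avg_step c L hL hg S s hs
    set κ := L / (2 * Fintype.card ι)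
    have h1 := avg_ge_one c S
    have h2 := avg_ge_one c (insert s S)
    set M := avg c S
    set M' := avg c (insert s S)
    have hl : 0 ≤ Real.log M := Real.log_nonneg h1
    have h3 : M' / M ≤ 1 - κ * Real.log M := by
      rw [div_le_iff₀ (by linarith)]; linarith
    have h4 := Real.log_le_sub_one_of_pos (x := M' / M) (by positivity)
    rw [Real.log_div (by positivity) (by positivity)] at h4
    have h5 : Real.log M' ≤ (1 - κ) * Real.log M := by linarith
    have h6 : 1 - κ ≤ Real.exp (-κ) := by linarith [Real.add_one_le_exp (-κ)]
    calc Real.log M' ≤ (1 - κ) * Real.log M := h5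
      _ ≤ Real.exp (-κ) * Real.log M := by gcongr
      _ ≤ Real.exp (-κ) * (Real.exp (-κ * S.card) * Real.log (Fintype.card V)) := by gcongr
      _ = _ := by
        rw [← mul_assoc, ← Real.exp_add, Finset.card_insert_of_notMem hs]
        push_cast
        congr 2
        ring

lemma exists_conn {ι V β : Type*} [Fintype ι] [DecidableEq ι] [Nonempty ι] [Fintype V] [Nonempty V]
    (c : ι → V → β) (L : ℝ) (hL : 0 ≤ L)
    (hg : ∀ A : Finset ι, L * (ncomp c A * Real.log (ncomp c A)) ≤
      ∑ i, 2 * ((ncomp c A : ℝ) - ncomp c (insert i A))) (d T : ℕ) (hd : 1 ≤ d)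
    (hT : d * T ≤ Fintype.card ι)
    (hlog : Real.exp (-(L / (2 * Fintype.card ι)) * T) * Real.log (Fintype.card V) <
      Real.log (1 + 1 / d)) :
    ∃ A : Fin d → Finset ι, (∀ j k, j ≠ k → Disjoint (A j) (A k)) ∧
      ∀ j, ∀ x y, comp c (A j) x y := by
  obtain ⟨g⟩ : Nonempty (Fin d × Fin T ↪ ι) :=
    Function.Embedding.nonempty_of_card_le (by simpa using hT)
  set B : Fin d → Finset ι := fun j => (univ : Finset (Fin T)).image (fun t => g (j, t)) with hB
  have hBc : ∀ j, (B j).card = T := by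
    intro j
    rw [hB]
    simp only
    rw [Finset.card_image_of_injective]
    · simp
    · intro a b h
      have := g.injective h
      simpa using this
  have hBd : ∀ j k, j ≠ k → Disjoint (B j) (B k) := by
    intro j k hjk
    rw [Finset.disjoint_left]
    intro x hx hx'
    simp only [hB, Finset.mem_image, Finset.mem_univ, true_and] at hx hx'
    obtain ⟨t, rfl⟩ := hx
    obtain ⟨t', h⟩ := hx'
    have := g.injective h
    simp only [Prod.mk.injEq] at this
    exact hjk this.1.symm
  have hdR : (0:ℝ) < d := by exact_mod_cast hd
  have hav : ∀ j, avg c (B j) < 1 + 1 / d := by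
    intro j
    have h := log_avg c L hL hg (B j)
    rw [hBc] at h
    have h1 := avg_ge_one c (B j)
    exact (Real.log_lt_log_iff (by linarith) (by positivity)).mp (lt_of_le_of_lt h hlog)
  have hP : (0:ℝ) < ((Fintype.card (Equiv.Perm ι) : ℕ) : ℝ) := by exact_mod_cast Fintype.card_pos
  have hex : ∃ σ : Equiv.Perm ι, ∀ j, ncomp c ((B j).image σ) = 1 := by
    by_contra hcon
    push Not at hcon
    have h1 : ∀ σ : Equiv.Perm ι, (d : ℝ) + 1 ≤ ∑ j, (ncomp c ((B j).image σ) : ℝ) := by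
      intro σ
      obtain ⟨j0, hj0⟩ := hcon σ
      have hlt : ∑ j : Fin d, 1 < ∑ j, ncomp c ((B j).image σ) := by
        apply Finset.sum_lt_sum
        · intro j _; exact ncomp_pos c _
        · exact ⟨j0, Finset.mem_univ _, lt_of_le_of_ne (ncomp_pos c _) (Ne.symm hj0)⟩
      simp only [Finset.sum_const, Finset.card_univ, Fintype.card_fin, smul_eq_mul, mul_one] at hlt
      exact_mod_cast hlt
    have h2 : ((Fintype.card (Equiv.Perm ι) : ℕ) : ℝ) * (d + 1) ≤
        ∑ σ : Equiv.Perm ι, ∑ j, (ncomp c ((B j).image σ) : ℝ) := by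
      calc _ = ∑ σ : Equiv.Perm ι, ((d:ℝ) + 1) := by
            rw [Finset.sum_const, Finset.card_univ, nsmul_eq_mul]
        _ ≤ _ := Finset.sum_le_sum (fun σ _ => h1 σ)
    rw [Finset.sum_comm] at h2
    have h3 : ∑ j, ∑ σ : Equiv.Perm ι, (ncomp c ((B j).image σ) : ℝ) =
        ((Fintype.card (Equiv.Perm ι) : ℕ) : ℝ) * ∑ j, avg c (B j) := by
      rw [Finset.mul_sum]
      apply Finset.sum_congr rfl
      intro j _
      unfold avg
      field_simp
    rw [h3] at h2
    have h4 := le_of_mul_le_mul_left h2 hP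
    have h5 : ∑ j, avg c (B j) < ∑ j : Fin d, (1 + 1 / (d:ℝ)) := by
      apply Finset.sum_lt_sum_of_nonempty
      · exact ⟨⟨0, hd⟩, Finset.mem_univ _⟩
      · intro j _; exact hav j
    rw [Finset.sum_const, Finset.card_univ, Fintype.card_fin, nsmul_eq_mul] at h5
    have : (d:ℝ) * (1 + 1 / d) = d + 1 := by field_simp
    linarith
  obtain ⟨σ, hσ⟩ := hex
  refine ⟨fun j => (B j).image σ, ?_, ?_⟩
  · intro j k hjk
    exact (Finset.disjoint_image σ.injective).mpr (hBd j k hjk)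
  · intro j x y
    have h := hσ j
    unfold ncomp at h
    have hs : Subsingleton (Quotient (comp c ((B j).image σ))) :=
      (Nat.card_eq_one_iff_unique.mp h).1
    exact Quotient.exact (Subsingleton.elim (Quotient.mk _ x) (Quotient.mk _ y))

open Classical in
lemma comb_main {ι V β : Type*} [Fintype ι] [Nonempty ι]
    (c : ι → V → β) (L B : ℝ) (hL : 0 ≤ L) (d T : ℕ) (hd : 1 ≤ d)
    (hT : d * T ≤ Fintype.card ι)
    (hlog : Real.exp (-(L / (2 * Fintype.card ι)) * T) * B < Real.log (1 + 1 / d))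
    (X : Finset V)
    (hno : ∀ Y : Finset V, Y ⊆ X → 2 ≤ Y.card →
      ¬ ∃ A : Fin d → Finset ι, (∀ j k, j ≠ k → Disjoint (A j) (A k)) ∧
      ∀ j, ∀ x y, comp (fun i (x : Y) => c i x) (A j) x y)
    (hB : Real.log X.card ≤ B) (k : ℕ) :
    ∀ Y : Finset V, Y ⊆ X → Y.card = k →
      ∑ i, ((Y.card : ℝ) - (Y.image (c i)).card) ≤ L * (Y.card * Real.log Y.card) := by
  induction k using Nat.strong_induction_on with
  | _ k ih =>
  intro Y hYX hYk
  rcases Nat.lt_or_ge Y.card 2 with h2 | h2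
  · have h : Y.card = 0 ∨ Y.card = 1 := by omega
    rcases h with h | h
    · have : Y = ∅ := Finset.card_eq_zero.mp h
      subst this
      simp
    · obtain ⟨a, rfl⟩ := Finset.card_eq_one.mp h
      simp
  · have hYne : Y.Nonempty := Finset.card_pos.mp (by omega)
    have : Nonempty Y := hYne.to_subtype
    have hXc : Y.card ≤ X.card := Finset.card_le_card hYX
    have hYpos : (0:ℝ) < Y.card := by exact_mod_cast hYne.card_pos
    have hlogY : Real.log Y.card ≤ B :=
      (Real.log_le_log hYpos (by exact_mod_cast hXc)).trans hB
    have hcut : ∃ S : Finset Y, S.Nonempty ∧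
        ((∑ i, ((S.image (fun x : Y => c i x)) ∩ (Sᶜ.image (fun x : Y => c i x))).card : ℕ) : ℝ) <
        L * (S.card * Real.log (Fintype.card Y / S.card)) := by
      by_contra hcon
      push Not at hcon
      apply hno Y hYX h2
      have hgs := gain_sum (fun i (x : Y) => c i x) L hL (by
        intro S hS
        refine le_trans (hcon S hS) (le_of_eq ?_)
        congr!)
      apply exists_conn (fun i (x : Y) => c i x) L hL hgs d T hd hT
      rw [Fintype.card_coe]
      refine lt_of_le_of_lt ?_ hlog
      gcongr
    obtain ⟨S, hSne, hS⟩ := hcut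
    rw [Fintype.card_coe] at hS
    set S' : Finset V := S.map (Function.Embedding.subtype _) with hS'
    have hcS : S'.card = S.card := Finset.card_map _
    have hS'Y : S' ⊆ Y := by
      intro x hx
      simp only [hS', Finset.mem_map, Function.Embedding.subtype_apply] at hx
      obtain ⟨a, _, rfl⟩ := hx
      exact a.2
    have him1 : ∀ i, S.image (fun x : Y => c i x) = S'.image (c i) := by
      intro i
      ext b
      simp [hS']
    have him2 : ∀ i, Sᶜ.image (fun x : Y => c i x) = (Y \ S').image (c i) := by
      intro i
      ext b
      simp only [Finset.mem_image, Finset.mem_compl, Finset.mem_sdiff, hS', Finset.mem_map,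
        Function.Embedding.subtype_apply]
      constructor
      · rintro ⟨a, ha, rfl⟩
        refine ⟨a, ⟨a.2, ?_⟩, rfl⟩
        rintro ⟨a', ha', h⟩
        exact ha (Subtype.ext h ▸ ha')
      · rintro ⟨a, ⟨ha, hn⟩, rfl⟩
        exact ⟨⟨a, ha⟩, fun h => hn ⟨_, h, rfl⟩, rfl⟩
    simp only [him1, him2] at hS
    rw [← hcS] at hS
    have hspos : 0 < S'.card := by rw [hcS]; exact hSne.card_pos
    have hcard : (Y \ S').card + S'.card = Y.card := Finset.card_sdiff_add_card_eq_card hS'Y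
    have hlt : S'.card < Y.card := by
      rcases Nat.lt_or_ge S'.card Y.card with h | h
      · exact h
      · exfalso
        have he : S'.card = Y.card := le_antisymm (Finset.card_le_card hS'Y) h
        rw [he, div_self hYpos.ne', Real.log_one, mul_zero, mul_zero] at hS
        have : (0:ℝ) ≤ ((∑ i, ((S'.image (c i)) ∩ ((Y \ S').image (c i))).card : ℕ) : ℝ) :=
          Nat.cast_nonneg _
        linarith
    have e1 := ih S'.card (by omega) S' (hS'Y.trans hYX) rfl
    have e2 := ih (Y \ S').card (by omega) (Y \ S') (Finset.sdiff_subset.trans hYX) rfl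
    have hsplit : ∑ i, ((Y.card : ℝ) - (Y.image (c i)).card) =
        ∑ i, ((S'.card : ℝ) - (S'.image (c i)).card) +
        ∑ i, (((Y \ S').card : ℝ) - ((Y \ S').image (c i)).card) +
        ((∑ i, ((S'.image (c i)) ∩ ((Y \ S').image (c i))).card : ℕ) : ℝ) := by
      push_cast
      rw [← Finset.sum_add_distrib, ← Finset.sum_add_distrib]
      apply Finset.sum_congr rfl
      intro i _
      have hu : Y.image (c i) = S'.image (c i) ∪ (Y \ S').image (c i) := by
        rw [← Finset.image_union, Finset.union_sdiff_of_subset hS'Y]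
      have := Finset.card_union_add_card_inter (S'.image (c i)) ((Y \ S').image (c i))
      rw [← hu] at this
      have h1 : ((Y.image (c i)).card : ℝ) + (S'.image (c i) ∩ (Y \ S').image (c i)).card =
        (S'.image (c i)).card + ((Y \ S').image (c i)).card := by exact_mod_cast this
      have h3 : ((Y \ S').card : ℝ) + S'.card = Y.card := by exact_mod_cast hcard
      linarith
    rw [hsplit]
    have hs : (0:ℝ) < S'.card := by exact_mod_cast hspos
    have ht : (0:ℝ) < (Y \ S').card := by
      have : 0 < (Y \ S').card := by omega
      exact_mod_cast this
    rw [Real.log_div hYpos.ne' hs.ne'] at hS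
    have hlt2 : Real.log (Y \ S').card ≤ Real.log Y.card :=
      Real.log_le_log ht (Nat.cast_le.mpr (Finset.card_le_card Finset.sdiff_subset))
    have h3 : ((Y \ S').card : ℝ) + S'.card = Y.card := by
      rw [← Nat.cast_add, hcard]
    have h5 : L * ((Y \ S').card * Real.log (Y \ S').card) ≤ L * ((Y \ S').card * Real.log Y.card) := by
      gcongr
    have h6 : L * (Y.card * Real.log Y.card) =
        L * ((Y \ S').card * Real.log Y.card) + L * (S'.card * Real.log Y.card) := by
      rw [← h3]; ring
    rw [h6]
    have h7 : L * (S'.card * (Real.log Y.card - Real.log S'.card)) =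
      L * (S'.card * Real.log Y.card) - L * (S'.card * Real.log S'.card) := by ring
    rw [h7] at hS
    linarith only [e1, e2, hS, h5]

end LR

namespace LR
open Finset

lemma noninj_count {F V W R : Type*} [Field F] [Finite F] [AddCommGroup V] [Module F V] [Finite V]
    [AddCommGroup W] [Module F W] [FiniteDimensional F W] [AddCommGroup R] [Module F R]
    (T : V →ₗ[F] W →ₗ[F] R) (M0 : V) (h0 : Function.Injective (T M0)) :
    Nat.card {M : V // ¬ Function.Injective (T M)} * (Nat.card F - 1) ≤
      Nat.card V * Module.finrank F W := by
  classical
  have := Fintype.ofFinite F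
  have := Fintype.ofFinite V
  obtain ⟨Lf, hLf⟩ := (T M0).exists_leftInverse_of_injective (LinearMap.ker_eq_bot.mpr h0)
  let b := Module.finBasis F W
  let N : V → Matrix (Fin (Module.finrank F W)) (Fin (Module.finrank F W)) F :=
    fun D => LinearMap.toMatrix b b (Lf ∘ₗ T D)
  let P : V → Polynomial F := fun D =>
    Matrix.det ((Polynomial.X : Polynomial F) • (N D).map Polynomial.C + (1 : Matrix (Fin (Module.finrank F W)) (Fin (Module.finrank F W)) F).map Polynomial.C)
  have hdeg : ∀ D, (P D).natDegree ≤ Module.finrank F W := by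
    intro D
    have := Polynomial.natDegree_det_X_add_C_le (N D) 1
    rw [Fintype.card_fin] at this
    exact this
  have heval : ∀ D t, (P D).eval t = Matrix.det (t • N D + 1) := by
    intro D t
    simp only [P]
    rw [← Polynomial.coe_evalRingHom, RingHom.map_det]
    congr 1
    ext i j
    rw [Matrix.add_apply, Matrix.smul_apply, RingHom.mapMatrix_apply, Matrix.map_apply,
      Matrix.add_apply, Matrix.smul_apply, Matrix.map_apply, Matrix.map_apply]
    generalize N D i j = a
    generalize (1 : Matrix (Fin (Module.finrank F W)) (Fin (Module.finrank F W)) F) i j = a'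
    simp only [smul_eq_mul, Polynomial.coe_evalRingHom, Polynomial.eval_add, Polynomial.eval_mul,
      Polynomial.eval_X, Polynomial.eval_C]
  have hP0 : ∀ D, P D ≠ 0 := by
    intro D h
    have := heval D 0
    rw [h] at this
    simp at this
  have hroot : ∀ D t, ¬ Function.Injective (T (M0 + t • D)) → t ∈ (P D).roots.toFinset := by
    intro D t hni
    rw [Multiset.mem_toFinset, Polynomial.mem_roots (hP0 D), Polynomial.IsRoot.def, heval]
    by_contra hdet
    apply hni
    have hcomp : LinearMap.toMatrix b b (Lf ∘ₗ T (M0 + t • D)) = t • N D + 1 := by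
      simp only [N, map_add, map_smul, LinearMap.comp_add, LinearMap.comp_smul, hLf]
      rw [LinearMap.toMatrix_id, add_comm]
    have hdet2 : LinearMap.det (Lf ∘ₗ T (M0 + t • D)) ≠ 0 := by
      rw [← LinearMap.det_toMatrix b, hcomp]; exact hdet
    have hinj : Function.Injective (Lf ∘ₗ T (M0 + t • D)) :=
      ((LinearMap.equivOfDetNeZero _ hdet2).injective)
    exact Function.Injective.of_comp (f := Lf) (by simpa using hinj)
  let Z : Finset (V × F) := univ.filter (fun z => z.2 ≠ 0 ∧ ¬ Function.Injective (T (M0 + z.2 • z.1)))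
  have hZ1 : Z.card ≤ Nat.card V * Module.finrank F W := by
    have h1 : Z ⊆ ((univ : Finset V).sigma (fun D => (P D).roots.toFinset)).image (fun z => (z.1, z.2)) := by
      intro z hz
      simp only [Z, Finset.mem_filter, Finset.mem_univ, true_and] at hz
      simp only [Finset.mem_image, Finset.mem_sigma, Finset.mem_univ, true_and]
      exact ⟨⟨z.1, z.2⟩, hroot _ _ hz.2, rfl⟩
    refine (Finset.card_le_card h1).trans (Finset.card_image_le.trans ?_)
    rw [Finset.card_sigma, Nat.card_eq_fintype_card, ← Finset.card_univ, ← smul_eq_mul]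
    apply Finset.sum_le_card_nsmul
    intro D _
    exact (Multiset.toFinset_card_le _).trans ((Polynomial.card_roots' _).trans (hdeg D))
  refine le_trans ?_ hZ1
  have h2 : Nat.card {M : V // ¬ Function.Injective (T M)} * (Nat.card F - 1) =
      ((univ.filter (fun M : V => ¬ Function.Injective (T M))) ×ˢ (univ.erase (0:F))).card := by
    rw [Finset.card_product, Finset.card_erase_of_mem (Finset.mem_univ _), Finset.card_univ,
      Nat.card_eq_fintype_card, Nat.card_eq_fintype_card, Fintype.card_subtype]
  rw [h2]
  apply Finset.card_le_card_of_injOn (fun z => (z.2⁻¹ • (z.1 - M0), z.2))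
  · intro z hz
    simp only [Finset.coe_product, Set.mem_prod, Finset.mem_coe, Finset.mem_filter,
      Finset.mem_univ, true_and, Finset.mem_erase, and_true] at hz
    simp only [Z, Finset.coe_filter, Finset.mem_univ, true_and, Set.mem_ofPred_eq]
    refine ⟨hz.2, ?_⟩
    rw [smul_smul, mul_inv_cancel₀ hz.2, one_smul, add_sub_cancel]
    exact hz.1
  · intro z hz z' hz' h
    simp only [Finset.coe_product, Set.mem_prod, Finset.mem_coe, Finset.mem_filter,
      Finset.mem_univ, true_and, Finset.mem_erase, and_true] at hz hz'
    simp only [Prod.mk.injEq] at h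
    obtain ⟨h1, h2⟩ := h
    rw [← h2] at h1
    have h3 : z.1 - M0 = z'.1 - M0 := smul_right_injective V (inv_ne_zero hz.2) h1
    exact Prod.ext (sub_left_injective h3) h2

/-- counting injective maps versus their ranges -/
lemma count_sub {F W : Type*} [Field F] [Finite F] [AddCommGroup W] [Module F W] [Finite W] (d : ℕ)
    (P : Submodule F W → Prop) :
    Nat.card {f : (Fin d → F) →ₗ[F] W // Function.Injective f ∧ P (LinearMap.range f)} =
      Nat.card {C : Submodule F W // Module.finrank F C = d ∧ P C} *
        Nat.card ((Fin d → F) ≃ₗ[F] (Fin d → F)) := by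
  classical
  have : FiniteDimensional F W := Module.Finite.of_finite
  have e : ∀ C : {C : Submodule F W // Module.finrank F C = d ∧ P C}, (Fin d → F) ≃ₗ[F] C.1 := by
    intro C
    exact LinearEquiv.ofFinrankEq _ _ (by rw [C.2.1]; simp)
  rw [← Nat.card_prod]
  symm
  apply Nat.card_eq_of_bijective
    (fun z : {C : Submodule F W // Module.finrank F C = d ∧ P C} × ((Fin d → F) ≃ₗ[F] (Fin d → F)) =>
      (⟨z.1.1.subtype ∘ₗ (z.2.trans (e z.1)).toLinearMap, by
        constructor
        · exact (Subtype.val_injective.comp ((e z.1).injective.comp z.2.injective))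
        · rw [LinearMap.range_comp, LinearEquiv.range, Submodule.map_top, Submodule.range_subtype]
          exact z.1.2.2⟩ :
        {f : (Fin d → F) →ₗ[F] W // Function.Injective f ∧ P (LinearMap.range f)}))
  constructor
  · rintro ⟨C, g⟩ ⟨C', g'⟩ h
    simp only [Subtype.mk.injEq] at h
    have hC : C = C' := by
      apply Subtype.ext
      have := congrArg LinearMap.range h
      rw [LinearMap.range_comp, LinearEquiv.range, Submodule.map_top, Submodule.range_subtype,
        LinearMap.range_comp, LinearEquiv.range, Submodule.map_top, Submodule.range_subtype] at this
      exact this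
    subst hC
    congr 1
    ext1 x
    have := LinearMap.congr_fun h x
    simpa using this
  · rintro ⟨f, hf, hP⟩
    have hfr : Module.finrank F (LinearMap.range f) = d := by
      rw [LinearMap.finrank_range_of_inj hf]; simp
    refine ⟨(⟨LinearMap.range f, hfr, hP⟩,
      (LinearEquiv.ofInjective f hf).trans (e ⟨LinearMap.range f, hfr, hP⟩).symm), ?_⟩
    apply Subtype.ext
    refine LinearMap.ext fun x => ?_
    simp

end LR
namespace LR
open Finset

/-- `f` has a nontrivial realisation of the incidence type `r` -/
def Bad {F : Type*} [Field F] {n d : ℕ} (k : ℕ) (r : Fin n → Fin k → Fin k → Bool)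
    (f : (Fin d → F) →ₗ[F] (Fin n → F)) : Prop :=
  ∃ y : Fin k → (Fin d → F), (∀ u, u.val = 0 → y u = 0) ∧ y ≠ 0 ∧
    ∀ i u v, r i u v = true → f (y u - y v) i = 0

lemma bad_count {F : Type*} [Field F] [Finite F] {n d : ℕ} (k : ℕ)
    (r : Fin n → Fin k → Fin k → Bool)
    (f0 : (Fin d → F) →ₗ[F] (Fin n → F)) (h0 : ¬ Bad k r f0) :
    Nat.card {f : (Fin d → F) →ₗ[F] (Fin n → F) // Bad k r f} * (Nat.card F - 1) ≤
      Nat.card ((Fin d → F) →ₗ[F] (Fin n → F)) * (k * d) := by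
  let W : Submodule F (Fin k → (Fin d → F)) :=
    { carrier := {y | ∀ u, u.val = 0 → y u = 0}
      add_mem' := by
        intro a b ha hb u hu
        simp [ha u hu, hb u hu]
      zero_mem' := by intro u _; rfl
      smul_mem' := by
        intro c a ha u hu
        simp [ha u hu] }
  let T : ((Fin d → F) →ₗ[F] (Fin n → F)) →ₗ[F] W →ₗ[F] (Fin n → Fin k → Fin k → F) :=
    LinearMap.mk₂ F (fun f y i u v => if r i u v = true then f (y.1 u - y.1 v) i else 0)
      (by
        intro f g y; funext i u v
        by_cases h : r i u v = true <;> simp [h])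
      (by
        intro c f y; funext i u v
        by_cases h : r i u v = true <;> simp [h])
      (by
        intro f y z; funext i u v
        by_cases h : r i u v = true
        · simp [h]; ring
        · simp [h])
      (by
        intro c f y; funext i u v
        by_cases h : r i u v = true
        · simp [h]; ring
        · simp [h])
  have hT : ∀ f, Bad k r f ↔ ¬ Function.Injective (T f) := by
    intro f
    rw [← LinearMap.ker_eq_bot, LinearMap.ker_eq_bot']
    push Not
    constructor
    · rintro ⟨y, hy0, hy, h⟩
      refine ⟨⟨y, hy0⟩, ?_, ?_⟩
      · funext i u v
        simp only [T, LinearMap.mk₂_apply]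
        by_cases hr : r i u v = true
        · simp only [hr, if_true]; exact h i u v hr
        · simp [hr]
      · intro h'
        exact hy (congrArg Subtype.val h')
    · rintro ⟨y, h, hy⟩
      refine ⟨y.1, y.2, fun h' => hy (Subtype.ext h'), ?_⟩
      intro i u v hr
      have := congrFun (congrFun (congrFun h i) u) v
      simp only [T, LinearMap.mk₂_apply, hr, if_true] at this
      exact this
  have hinj : Function.Injective (T f0) := by
    by_contra h; exact h0 ((hT f0).mpr h)
  have : Finite ((Fin d → F) →ₗ[F] (Fin n → F)) := Module.finite_of_finite F
  have hc := noninj_count T f0 hinj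
  simp only [← hT] at hc
  refine hc.trans (Nat.mul_le_mul_left _ ?_)
  refine (Submodule.finrank_le W).trans (le_of_eq ?_)
  rw [Module.finrank_pi_fintype]
  simp

/-- total bad event -/
def BadAll {F : Type*} [Field F] {n d : ℕ} (f : (Fin d → F) →ₗ[F] (Fin n → F)) : Prop :=
  ¬ Function.Injective f ∨ ∃ k ∈ range (3 ^ n + 1), ∃ r : Fin n → Fin k → Fin k → Bool,
    (∃ f0 : (Fin d → F) →ₗ[F] (Fin n → F), ¬ Bad k r f0) ∧ Bad k r f

/-- constant in the union bound -/
def QQ (n d : ℕ) : ℕ := d + ∑ k ∈ range (3 ^ n + 1), ∑ _r : Fin n → Fin k → Fin k → Bool, k * d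

lemma badAll_count {F : Type*} [Field F] [Finite F] {n d : ℕ} (hdn : d ≤ n) :
    Nat.card {f : (Fin d → F) →ₗ[F] (Fin n → F) // BadAll f} * (Nat.card F - 1) ≤
      Nat.card ((Fin d → F) →ₗ[F] (Fin n → F)) * QQ n d := by
  classical
  have : Finite ((Fin d → F) →ₗ[F] (Fin n → F)) := Module.finite_of_finite F
  have := Fintype.ofFinite ((Fin d → F) →ₗ[F] (Fin n → F))
  let U1 : Finset ((Fin d → F) →ₗ[F] (Fin n → F)) := univ.filter (fun f => ¬ Function.Injective f)
  let U2 : (k : ℕ) → (Fin n → Fin k → Fin k → Bool) → Finset ((Fin d → F) →ₗ[F] (Fin n → F)) :=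
    fun k r => univ.filter (fun f => (∃ f0 : (Fin d → F) →ₗ[F] (Fin n → F), ¬ Bad k r f0) ∧ Bad k r f)
  have h1 : U1.card * (Nat.card F - 1) ≤ Nat.card ((Fin d → F) →ₗ[F] (Fin n → F)) * d := by
    have hinj : Function.Injective (LinearMap.funLeft F F
        (fun i : Fin n => if h : i.val < d then some (⟨i.val, h⟩ : Fin d) else none) ∘ₗ
        (LinearMap.pi (fun o : Option (Fin d) => o.elim (0 : (Fin d → F) →ₗ[F] F)
          (fun j => LinearMap.proj j)))) := by
      intro x y hxy
      funext j
      have := congrFun hxy ⟨j.val, lt_of_lt_of_le j.2 hdn⟩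
      simpa [LinearMap.funLeft] using this
    have := noninj_count (LinearMap.id : ((Fin d → F) →ₗ[F] (Fin n → F)) →ₗ[F] _) _ hinj
    simp only [LinearMap.id_apply] at this
    rw [Module.finrank_fin_fun] at this
    rw [Nat.card_eq_fintype_card, Fintype.card_subtype] at this
    exact this
  have h2 : ∀ k r, (U2 k r).card * (Nat.card F - 1) ≤
      Nat.card ((Fin d → F) →ₗ[F] (Fin n → F)) * (k * d) := by
    intro k r
    by_cases h : ∃ f0 : (Fin d → F) →ₗ[F] (Fin n → F), ¬ Bad k r f0
    · obtain ⟨f0, hf0⟩ := h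
      refine le_trans (Nat.mul_le_mul_right _ ?_) (bad_count k r f0 hf0)
      rw [Nat.card_eq_fintype_card, Fintype.card_subtype]
      apply Finset.card_le_card
      intro f hf
      simp only [U2, Finset.mem_filter, Finset.mem_univ, true_and] at hf ⊢
      exact hf.2
    · simp [U2, h]
  have hsub : (univ.filter (fun f : (Fin d → F) →ₗ[F] (Fin n → F) => BadAll f)) ⊆
      U1 ∪ (range (3 ^ n + 1)).biUnion (fun k => univ.biUnion (fun r => U2 k r)) := by
    intro f hf
    simp only [Finset.mem_filter, Finset.mem_univ, true_and] at hf
    simp only [Finset.mem_union, Finset.mem_biUnion, U1, U2, Finset.mem_filter, Finset.mem_univ, true_and]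
    exact hf
  have hcard : (univ.filter (fun f : (Fin d → F) →ₗ[F] (Fin n → F) => BadAll f)).card ≤
      U1.card + ∑ k ∈ range (3 ^ n + 1), ∑ r, (U2 k r).card := by
    refine (Finset.card_le_card hsub).trans ((Finset.card_union_le _ _).trans ?_)
    gcongr
    refine Finset.card_biUnion_le.trans ?_
    gcongr
    exact Finset.card_biUnion_le
  rw [Nat.card_eq_fintype_card, Fintype.card_subtype]
  refine (Nat.mul_le_mul_right _ hcard).trans ?_
  unfold QQ
  rw [add_mul, mul_add, Finset.sum_mul, Finset.mul_sum]
  simp only [Finset.sum_mul, Finset.mul_sum]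
  exact add_le_add h1 (Finset.sum_le_sum fun k _ => Finset.sum_le_sum fun r _ => h2 k r)

lemma struct {F : Type*} [Field F] {n d : ℕ} (f : (Fin d → F) →ₗ[F] (Fin n → F))
    (Y : Finset (Fin n → F)) (hY : ∀ x ∈ Y, ∃ z, f z = x) (h2 : 2 ≤ Y.card) (h3 : Y.card ≤ 3 ^ n)
    (A : Fin d → Finset (Fin n)) (hA : ∀ j k, j ≠ k → Disjoint (A j) (A k))
    (hc : ∀ j, ∀ x y, comp (fun i (x : Y) => x.1 i) (A j) x y) : BadAll f := by
  classical
  right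
  refine ⟨Y.card, by simp; omega, ?_⟩
  let e : Fin Y.card ≃ Y := Y.equivFin.symm
  let r : Fin n → Fin Y.card → Fin Y.card → Bool := fun i u v => decide ((e u).1 i = (e v).1 i)
  let u0 : Fin Y.card := ⟨0, by omega⟩
  let u1 : Fin Y.card := ⟨1, by omega⟩
  choose g hg using fun x : Y => hY x.1 x.2
  refine ⟨r, ?_, ?_⟩
  · let f0 : (Fin d → F) →ₗ[F] (Fin n → F) :=
      LinearMap.pi (fun i => ∑ j, if i ∈ A j then (LinearMap.proj j : (Fin d → F) →ₗ[F] F) else 0)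
    have hf0 : ∀ i j x, i ∈ A j → f0 x i = x j := by
      intro i j x hij
      simp only [f0, LinearMap.pi_apply, LinearMap.sum_apply]
      rw [Finset.sum_eq_single j]
      · simp [hij]
      · intro k _ hk
        have : i ∉ A k := fun h => (Finset.disjoint_left.mp (hA j k hk.symm)) hij h
        simp [this]
      · simp
    refine ⟨f0, ?_⟩
    rintro ⟨y, hy0, hy, h⟩
    apply hy
    funext u j
    have hle : comp (fun i (x : Y) => x.1 i) (A j) ≤ Setoid.ker (fun x : Y => y (e.symm x) j) := by
      apply iSup₂_le
      intro i hi x x' hxx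
      have hxx' : x.1 i = x'.1 i := hxx
      have := h i (e.symm x) (e.symm x') (by simp [r, hxx'])
      rw [hf0 i j _ hi] at this
      exact sub_eq_zero.mp this
    have := hle (hc j (e u) (e u0))
    have h' : y (e.symm (e u)) j = y (e.symm (e u0)) j := this
    rw [Equiv.symm_apply_apply, Equiv.symm_apply_apply, hy0 u0 rfl] at h'
    simpa using h'
  · refine ⟨fun u => g (e u) - g (e u0), ?_, ?_, ?_⟩
    · intro u hu
      have : u = u0 := Fin.ext hu
      rw [this]
      exact sub_self _
    · intro h
      have h1 := congrFun h u1
      have h2 : g (e u1) = g (e u0) := sub_eq_zero.mp h1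
      have h3 : (e u1).1 = (e u0).1 := by rw [← hg, ← hg, h2]
      have h4 := e.injective (Subtype.ext h3)
      have h5 := congrArg Fin.val h4
      simp [u0, u1] at h5
    · intro i u v hr
      simp only [r, decide_eq_true_eq] at hr
      rw [sub_sub_sub_cancel_right, map_sub, hg, hg, Pi.sub_apply, hr, sub_self]

lemma recover {p n d : ℕ} [Fact p.Prime] (hn : 0 < n) (hd : 1 ≤ d)
    (f : (Fin d → ZMod p) →ₗ[ZMod p] (Fin n → ZMod p)) (hf : ¬ BadAll f)
    (α ε : ℝ) (hα : α ∈ Set.Ioo (0 : ℝ) 1) (hε : ε ∈ Set.Ioo (0 : ℝ) 1)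
    (L B : ℝ) (hL : 0 ≤ L) (T : ℕ) (hT : d * T ≤ n)
    (hlog : Real.exp (-(L / (2 * n)) * T) * B < Real.log (1 + 1 / d))
    (hB3 : Real.exp B ≤ 3 ^ n) (hLB : L * B ≤ (1 - α) * ε / 2 * n)
    (ℓ : ℕ) (hℓB : Real.log ((1 + ε) / (1 - α) * ℓ + 1) ≤ B) :
    ListRecoverable (LinearMap.range f : Set (Fin n → ZMod p)) α ℓ ((1 + ε) / (1 - α) * ℓ) := by
  classical
  obtain ⟨hα0, hα1⟩ := hα
  obtain ⟨hε0, hε1⟩ := hε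
  have h1α : 0 < 1 - α := by linarith
  intro S hS
  by_contra hcon
  rw [not_le, Nat.card_eq_fintype_card, Fintype.card_subtype] at hcon
  set Xall : Finset (Fin n → ZMod p) := univ.filter (fun x => x ∈ (LinearMap.range f : Set (Fin n → ZMod p)) ∧
      (Nat.card {i : Fin n // x i ∉ S i} : ℝ) ≤ α * (n : ℝ)) with hXall
  set lam := (1 + ε) / (1 - α) * ℓ with hlam
  have hlam0 : 0 ≤ lam := by positivity
  have hNle : ⌊lam⌋₊ + 1 ≤ Xall.card := (Nat.floor_lt hlam0).mpr hcon
  obtain ⟨X, hXsub, hXcard⟩ := Finset.exists_subset_card_eq hNle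
  have hNlt : lam < X.card := by rw [hXcard]; push_cast; exact Nat.lt_floor_add_one lam
  have hNle1 : (X.card : ℝ) ≤ lam + 1 := by
    rw [hXcard]; push_cast; linarith [Nat.floor_le hlam0]
  have hNpos : (0:ℝ) < X.card := lt_of_le_of_lt hlam0 hNlt
  have hlogN : Real.log X.card ≤ B := (Real.log_le_log hNpos hNle1).trans hℓB
  have hN3 : X.card ≤ 3 ^ n := by
    have : (X.card : ℝ) ≤ 3 ^ n := by
      rw [← Real.exp_log hNpos]
      exact (Real.exp_le_exp.mpr hlogN).trans hB3
    exact_mod_cast this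
  have hXmem : ∀ x ∈ X, (∃ z, f z = x) ∧ (Nat.card {i : Fin n // x i ∉ S i} : ℝ) ≤ α * (n : ℝ) := by
    intro x hx
    have := hXsub hx
    simp only [hXall, Finset.mem_filter, Finset.mem_univ, true_and] at this
    exact this
  have : Nonempty (Fin n) := ⟨⟨0, hn⟩⟩
  have hcomb := comb_main (fun (i : Fin n) (x : Fin n → ZMod p) => x i) L B hL d T hd
    (by simpa using hT) (by simpa using hlog) X (by
      rintro Y hYX hY2 ⟨A, hA, hc⟩
      apply hf
      exact struct f Y (fun x hx => (hXmem x (hYX hx)).1) hY2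
        ((Finset.card_le_card hYX).trans hN3) A hA hc) hlogN X.card X (Finset.Subset.refl _) rfl
  have hnR : (0:ℝ) < n := by exact_mod_cast hn
  have hub : ∑ i : Fin n, ((X.card : ℝ) - (X.image (fun x => x i)).card) ≤ (1 - α) * ε / 2 * n * X.card := by
    calc _ ≤ L * (X.card * Real.log X.card) := by convert hcomb
      _ ≤ L * (X.card * B) := by gcongr
      _ = L * B * X.card := by ring
      _ ≤ _ := by gcongr
  have hper : ∀ i : Fin n, ((X.filter (fun x => x i ∈ S i)).card : ℝ) ≤
      ℓ + ((X.card : ℝ) - (X.image (fun x => x i)).card) := by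
    intro i
    have h1 : (X.image (fun x => x i)).card ≤ (S i).card + (X.filter (fun x => ¬ x i ∈ S i)).card := by
      have hsub : X.image (fun x => x i) ⊆ S i ∪ (X.filter (fun x => ¬ x i ∈ S i)).image (fun x => x i) := by
        intro b hb
        simp only [Finset.mem_image] at hb
        obtain ⟨x, hx, rfl⟩ := hb
        by_cases h : x i ∈ S i
        · exact Finset.mem_union_left _ h
        · exact Finset.mem_union_right _ (Finset.mem_image.mpr ⟨x, by simp [hx, h], rfl⟩)
      refine (Finset.card_le_card hsub).trans ((Finset.card_union_le _ _).trans ?_)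
      gcongr
      exact Finset.card_image_le
    rw [hS i] at h1
    have h2 := Finset.card_filter_add_card_filter_not (s := X) (fun x => x i ∈ S i)
    have h1' : ((X.image (fun x => x i)).card : ℝ) ≤ ℓ + (X.filter (fun x => ¬ x i ∈ S i)).card := by
      exact_mod_cast h1
    have h2' : ((X.filter (fun x => x i ∈ S i)).card : ℝ) + (X.filter (fun x => ¬ x i ∈ S i)).card = X.card := by
      exact_mod_cast h2
    linarith
  have hlow : (X.card : ℝ) * ((1 - α) * n) ≤ ∑ i : Fin n, ((X.filter (fun x => x i ∈ S i)).card : ℝ) := by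
    have hsw : ∑ i : Fin n, ((X.filter (fun x => x i ∈ S i)).card : ℝ) =
        ∑ x ∈ X, ((univ.filter (fun i : Fin n => x i ∈ S i)).card : ℝ) := by
      simp only [Finset.card_filter]
      push_cast
      rw [Finset.sum_comm]
    rw [hsw, ← nsmul_eq_mul]
    apply Finset.card_nsmul_le_sum
    intro x hx
    have h := (hXmem x hx).2
    rw [Nat.card_eq_fintype_card, Fintype.card_subtype] at h
    have h2 := Finset.card_filter_add_card_filter_not (s := (univ : Finset (Fin n))) (fun i => x i ∈ S i)
    rw [Finset.card_univ, Fintype.card_fin] at h2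
    have h2' : ((univ.filter (fun i : Fin n => x i ∈ S i)).card : ℝ) +
        (univ.filter (fun i : Fin n => ¬ x i ∈ S i)).card = n := by exact_mod_cast h2
    linarith
  have hsum : ∑ i : Fin n, ((X.filter (fun x => x i ∈ S i)).card : ℝ) ≤
      n * ℓ + (1 - α) * ε / 2 * n * X.card := by
    calc _ ≤ ∑ i : Fin n, ((ℓ : ℝ) + ((X.card : ℝ) - (X.image (fun x => x i)).card)) :=
          Finset.sum_le_sum (fun i _ => hper i)
      _ = n * ℓ + ∑ i : Fin n, ((X.card : ℝ) - (X.image (fun x => x i)).card) := by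
          rw [Finset.sum_add_distrib, Finset.sum_const, Finset.card_univ, Fintype.card_fin, nsmul_eq_mul]
      _ ≤ _ := by gcongr
  have hfin : (X.card : ℝ) * (1 - α) ≤ ℓ + (1 - α) * ε / 2 * X.card := by
    have : (n : ℝ) * (X.card * (1 - α)) ≤ n * (ℓ + (1 - α) * ε / 2 * X.card) := by linarith
    exact le_of_mul_le_mul_left this hnR
  have hl : (1 + ε) * ℓ < X.card * (1 - α) := by
    rw [hlam, div_mul_eq_mul_div, div_lt_iff₀ h1α] at hNlt
    exact hNlt
  set N : ℝ := (X.card : ℝ)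
  have h5 : (1 + ε) * (N * (1 - α)) ≤ (1 + ε) * (ℓ + (1 - α) * ε / 2 * N) := by gcongr
  have h6 : 0 < N * (1 - α) * ε := by positivity
  have h7 : N * (1 - α) * ε * ε < N * (1 - α) * ε * 1 := by gcongr
  nlinarith

end LR

namespace LR

lemma count_final {p n d : ℕ} [Fact p.Prime] (hdn : d ≤ n) (hd : 1 ≤ d) (ε : ℝ) (hε0 : 0 < ε)
    (hp : ⌈2 * (QQ n d : ℝ) / ε⌉₊ + 2 ≤ p)
    (P : Submodule (ZMod p) (Fin n → ZMod p) → Prop)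
    (hP : ∀ f : (Fin d → ZMod p) →ₗ[ZMod p] (Fin n → ZMod p), ¬ BadAll f → P (LinearMap.range f)) :
    (1 - ε) * (Nat.card {C : Submodule (ZMod p) (Fin n → ZMod p) //
        Module.finrank (ZMod p) C = d} : ℝ) ≤
      (Nat.card {C : Submodule (ZMod p) (Fin n → ZMod p) // Module.finrank (ZMod p) C = d ∧ P C} : ℝ) := by
  classical
  have : Finite ((Fin d → ZMod p) →ₗ[ZMod p] (Fin n → ZMod p)) := Module.finite_of_finite (ZMod p)
  have : Finite ((Fin d → ZMod p) →ₗ[ZMod p] (Fin d → ZMod p)) := Module.finite_of_finite (ZMod p)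
  have : Finite ((Fin d → ZMod p) ≃ₗ[ZMod p] (Fin d → ZMod p)) :=
    Finite.of_injective (fun e => e.toLinearMap) LinearEquiv.toLinearMap_injective
  have c1 := count_sub (F := ZMod p) (W := Fin n → ZMod p) d (fun _ => True)
  have c2 := count_sub (F := ZMod p) (W := Fin n → ZMod p) d P
  simp only [and_true] at c1
  set g := Nat.card ((Fin d → ZMod p) ≃ₗ[ZMod p] (Fin d → ZMod p)) with hg
  have hgpos : (0:ℝ) < g := by
    have : 0 < g := Nat.card_pos
    exact_mod_cast this
  set tot := Nat.card ((Fin d → ZMod p) →ₗ[ZMod p] (Fin n → ZMod p)) with htot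
  have hbad := badAll_count (F := ZMod p) (n := n) (d := d) hdn
  rw [← htot, Nat.card_zmod] at hbad
  set bad := Nat.card {f : (Fin d → ZMod p) →ₗ[ZMod p] (Fin n → ZMod p) // BadAll f}
  have hinj : Nat.card {f : (Fin d → ZMod p) →ₗ[ZMod p] (Fin n → ZMod p) // Function.Injective f} ≤ tot :=
    Nat.card_le_card_of_injective _ Subtype.val_injective
  have hgood : tot ≤ bad + Nat.card {f : (Fin d → ZMod p) →ₗ[ZMod p] (Fin n → ZMod p) //
      Function.Injective f ∧ P (LinearMap.range f)} := by
    rw [← Nat.card_sum]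
    apply Nat.card_le_card_of_surjective (Sum.elim Subtype.val Subtype.val)
    intro f
    by_cases h : BadAll f
    · exact ⟨Sum.inl ⟨f, h⟩, rfl⟩
    · refine ⟨Sum.inr ⟨f, ?_, hP f h⟩, rfl⟩
      by_contra hi
      exact h (Or.inl hi)
  rw [c1] at hinj
  rw [c2] at hgood
  set Sall := Nat.card {C : Submodule (ZMod p) (Fin n → ZMod p) // Module.finrank (ZMod p) C = d}
  set Sg := Nat.card {C : Submodule (ZMod p) (Fin n → ZMod p) // Module.finrank (ZMod p) C = d ∧ P C}
  have hQ : (0:ℝ) < QQ n d := by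
    have : 0 < QQ n d := by unfold QQ; omega
    exact_mod_cast this
  have hbR : (bad : ℝ) * (2 * (QQ n d : ℝ) / ε) ≤ tot * QQ n d := by
    have h1 : 2 * (QQ n d : ℝ) / ε ≤ ((p - 1 : ℕ) : ℝ) := by
      refine (Nat.le_ceil _).trans ?_
      exact Nat.cast_le.mpr (by omega)
    calc _ ≤ (bad : ℝ) * ((p - 1 : ℕ) : ℝ) := by gcongr
      _ ≤ _ := by exact_mod_cast hbad
  have hb2 : (bad : ℝ) ≤ ε / 2 * tot := by
    have h : (2 * (QQ n d : ℝ) / ε) * bad ≤ (2 * (QQ n d : ℝ) / ε) * (ε / 2 * tot) := by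
      have : (2 * (QQ n d : ℝ) / ε) * (ε / 2 * tot) = tot * QQ n d := by field_simp
      rw [this]; linarith
    exact le_of_mul_le_mul_left h (by positivity)
  have hi : (Sall : ℝ) * g ≤ tot := by exact_mod_cast hinj
  have hg2 : (tot : ℝ) ≤ bad + Sg * g := by exact_mod_cast hgood
  have ht0 : (0:ℝ) ≤ tot := Nat.cast_nonneg _
  have hS0 : (0:ℝ) ≤ Sall := Nat.cast_nonneg _
  have hSg0 : (0:ℝ) ≤ Sg := Nat.cast_nonneg _
  rcases le_or_gt ε 1 with h1 | h1
  · have h : (g : ℝ) * ((1 - ε) * Sall) ≤ g * Sg := by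
      have : (1 - ε) * (Sall * g) ≤ (1 - ε) * tot := by
        apply mul_le_mul_of_nonneg_left hi; linarith
      have h3 : 0 ≤ ε / 2 * tot := by positivity
      linarith
    exact le_of_mul_le_mul_left h hgpos
  · have : (1 - ε) * (Sall : ℝ) ≤ 0 := mul_nonpos_of_nonpos_of_nonneg (by linarith) hS0
    linarith

lemma analytic (η c : ℝ) (hη0 : 0 < η) (hη1 : η ≤ 1 / 2) (hc : 1 ≤ c) (d n : ℕ) (hd : 1 ≤ d)
    (hn : 2 * (18 * c / η) * (Real.log (2 * (18 * c / η)) + 1) * ((d : ℝ) * Real.log d + 1) ≤ n) :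
    72 * d ≤ n ∧ 1 ≤ Real.log n ∧
    9 * d * Real.log n * (c + η / (18 * d) * n / Real.log n) ≤ η * n ∧
    c + η / (18 * d) * n / Real.log n ≤ n ∧
    Real.exp (-(9 * d * Real.log n / (2 * n)) * ((n / d : ℕ) : ℝ)) *
      (c + η / (18 * d) * n / Real.log n) < Real.log (1 + 1 / d) := by
  set a := 18 * c / η with ha
  have hdR : (1:ℝ) ≤ d := by exact_mod_cast hd
  have haη : a * η = 18 * c := by rw [ha]; field_simp
  have ha36 : 36 * c ≤ a := by
    rw [ha, le_div_iff₀ hη0]; nlinarith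
  have ha0 : 0 < a := by linarith
  have hD1 : (d : ℝ) ≤ (d : ℝ) * Real.log d + 1 := by
    have h := Real.one_sub_inv_le_log_of_pos (x := (d:ℝ)) (by linarith)
    have : (d:ℝ) * (1 - (d:ℝ)⁻¹) ≤ d * Real.log d := by gcongr
    have h2 : (d:ℝ) * (1 - (d:ℝ)⁻¹) = d - 1 := by field_simp
    linarith
  have hl2a : 0 ≤ Real.log (2 * a) := Real.log_nonneg (by linarith)
  have hld : 0 ≤ Real.log (d:ℝ) := Real.log_nonneg hdR
  set D := (d : ℝ) * Real.log d + 1 with hD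
  have hn1 : 2 * a * (d * Real.log (2 * a)) + 2 * a * (d * Real.log d) ≤ n := by
    have : Real.log (2 * a) * d ≤ Real.log (2 * a) * D := by gcongr
    have h2 : (d * Real.log (2 * a)) + (d * Real.log d) ≤ (Real.log (2 * a) + 1) * D := by
      rw [add_mul, one_mul]; linarith
    have h3 : 2 * a * ((d * Real.log (2 * a)) + (d * Real.log d)) ≤ 2 * a * ((Real.log (2 * a) + 1) * D) := by
      gcongr
    linarith
  have hn2 : 2 * a * d ≤ n := by
    have h2 : (d : ℝ) ≤ (Real.log (2 * a) + 1) * D := by nlinarith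
    have h3 : 2 * a * d ≤ 2 * a * ((Real.log (2 * a) + 1) * D) := by gcongr
    linarith
  have hn3 : 72 * c * d ≤ n := by
    have : 2 * (36 * c) * d ≤ 2 * a * d := by gcongr
    linarith
  have hn72 : (72:ℝ) * d ≤ n := by
    have : 72 * 1 * (d:ℝ) ≤ 72 * c * d := by gcongr
    linarith
  have hnc : 72 * c ≤ n := by
    have : 72 * c * 1 ≤ 72 * c * (d:ℝ) := by gcongr
    linarith
  have hnpos : (0:ℝ) < n := by linarith
  have hlogn : 1 ≤ Real.log n := by
    rw [Real.le_log_iff_exp_le hnpos]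
    linarith [Real.exp_one_lt_d9]
  have hadlog : a * d * Real.log n ≤ n := by
    have h := Real.log_le_sub_one_of_pos (x := (n:ℝ) / (2 * a * d)) (by positivity)
    rw [Real.log_div (by positivity) (by positivity), Real.log_mul (by positivity) (by positivity)] at h
    have h2 : a * d * (Real.log n - (Real.log (2 * a) + Real.log d)) ≤ a * d * (n / (2 * a * d) - 1) := by
      gcongr
    have h3 : a * d * (n / (2 * a * d) - 1) = n / 2 - a * d := by field_simp
    have h4 : 0 < a * d := by positivity
    linarith
  have hdl : η / (18 * d) * n / Real.log n ≤ n / 2 := by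
    rw [div_le_iff₀ (by linarith)]
    have h1 : η / (18 * d) ≤ 1 / 2 := by
      rw [div_le_iff₀ (by positivity)]; linarith
    calc η / (18 * d) * n ≤ 1 / 2 * n := by gcongr
      _ = n / 2 * 1 := by ring
      _ ≤ n / 2 * Real.log n := by gcongr
  have hBn : c + η / (18 * d) * n / Real.log n ≤ n := by linarith
  have hB0 : 0 ≤ c + η / (18 * d) * n / Real.log n := by positivity
  refine ⟨by exact_mod_cast hn72, hlogn, ?_, hBn, ?_⟩
  · have h1 : 9 * d * Real.log n * (c + η / (18 * d) * n / Real.log n) =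
        9 * c * d * Real.log n + η / 2 * n := by
      field_simp; ring
    have h2 : 9 * c * d * Real.log n = η / 2 * (a * d * Real.log n) := by
      have : 9 * c = η / 2 * a := by linarith
      rw [this]; ring
    have h3 : η / 2 * (a * d * Real.log n) ≤ η / 2 * n := by gcongr
    rw [h1, h2]; linarith
  · have hT : (n:ℝ) / (2 * d) ≤ ((n / d : ℕ) : ℝ) := by
      have h1 := Nat.lt_div_mul_add (a := n) (b := d) (by omega)
      have h2 : (n:ℝ) < ((n / d : ℕ) : ℝ) * d + d := by exact_mod_cast h1
      rw [div_le_iff₀ (by positivity)]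
      linarith
    have hexp : -(9 * d * Real.log n / (2 * n)) * ((n / d : ℕ) : ℝ) ≤ -(2 * Real.log n) := by
      have h1 : 9 * d * Real.log n / (2 * n) * ((n:ℝ) / (2 * d)) ≤
          9 * d * Real.log n / (2 * n) * ((n / d : ℕ) : ℝ) := by gcongr
      have h2 : 9 * d * Real.log n / (2 * n) * ((n:ℝ) / (2 * d)) = 9 / 4 * Real.log n := by
        field_simp; ring
      linarith
    have hexp2 : Real.exp (-(9 * d * Real.log n / (2 * n)) * ((n / d : ℕ) : ℝ)) ≤ ((n:ℝ) * n)⁻¹ := by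
      refine (Real.exp_le_exp.mpr hexp).trans (le_of_eq ?_)
      rw [Real.exp_neg, two_mul, Real.exp_add, Real.exp_log hnpos]
    calc _ ≤ ((n:ℝ) * n)⁻¹ * n := by gcongr
      _ = 1 / n := by field_simp
      _ < 1 / (d + 1) := by
        apply one_div_lt_one_div_of_lt <;> linarith
      _ = 1 - (1 + 1 / (d:ℝ))⁻¹ := by field_simp; ring
      _ ≤ _ := Real.one_sub_inv_le_log_of_pos (by positivity)

end LR

/-- Main theorem: for all `α, ε ∈ (0,1)` and `d ≥ 1` there are `δ > 0`,
`n₀ = O_{α,ε}(d log d)`, and a computable `f` such that for every `n ≥ n₀` and prime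
`p ≥ f(n)`, a uniformly random `d`-dimensional linear code `C ⊆ 𝔽_p^n` is, with
probability at least `1 - ε`, `(α, ℓ, ((1+ε)/(1-α)) ℓ)`-list recoverable simultaneously
for all positive integers `ℓ ≤ 2^{δ n / log n}`.  (The probability statement is phrased
as a count over all `d`-dimensional subspaces.) -/
theorem stmt_19 (α ε : ℝ) (hα : α ∈ Set.Ioo (0 : ℝ) 1) (hε : ε ∈ Set.Ioo (0 : ℝ) 1) :
    ∃ K : ℝ, 0 < K ∧ ∀ d : ℕ, 1 ≤ d →
      ∃ (δ : ℝ) (n₀ : ℕ) (f : ℕ → ℕ), 0 < δ ∧ 0 < n₀ ∧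
        (n₀ : ℝ) ≤ K * ((d : ℝ) * Real.log (d : ℝ) + 1) ∧
        ∀ n : ℕ, n₀ ≤ n → ∀ p : ℕ, p.Prime → f n ≤ p →
          (1 - ε) * (Nat.card {C : Submodule (ZMod p) (Fin n → ZMod p) //
              Module.finrank (ZMod p) C = d} : ℝ) ≤
            (Nat.card {C : Submodule (ZMod p) (Fin n → ZMod p) //
              Module.finrank (ZMod p) C = d ∧
              ∀ ℓ : ℕ, 0 < ℓ → (ℓ : ℝ) ≤ (2 : ℝ) ^ (δ * (n : ℝ) / Real.log (n : ℝ)) →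
                ListRecoverable (C : Set (Fin n → ZMod p)) α ℓ
                  (((1 + ε) / (1 - α)) * (ℓ : ℝ))} : ℝ) := by
  obtain ⟨hα0, hα1⟩ := id hα
  obtain ⟨hε0, hε1⟩ := id hε
  have h1α : 0 < 1 - α := by linarith
  set η : ℝ := (1 - α) * ε / 2 with hη
  have hη0 : 0 < η := by positivity
  have hη1 : η ≤ 1 / 2 := by rw [hη]; nlinarith
  set c : ℝ := Real.log (2 / (1 - α) + 1) with hc
  have h2α : 2 ≤ 2 / (1 - α) := by rw [le_div_iff₀ h1α]; linarith
  have hc1 : 1 ≤ c := by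
    rw [hc, Real.le_log_iff_exp_le (by linarith)]
    linarith [Real.exp_one_lt_d9]
  set K0 : ℝ := 2 * (18 * c / η) * (Real.log (2 * (18 * c / η)) + 1) with hK0
  have hK0pos : 0 < K0 := by
    have : 1 ≤ 2 * (18 * c / η) := by
      rw [← mul_div_assoc, le_div_iff₀ hη0]; linarith
    have := Real.log_nonneg this
    positivity
  refine ⟨K0 + 1, by linarith, ?_⟩
  intro d hd
  have hdR : (1:ℝ) ≤ d := by exact_mod_cast hd
  have hD0 : 0 ≤ (d:ℝ) * Real.log d := mul_nonneg (by linarith) (Real.log_nonneg hdR)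
  refine ⟨η / (18 * d), ⌈K0 * ((d:ℝ) * Real.log d + 1)⌉₊,
    fun n => ⌈2 * (LR.QQ n d : ℝ) / ε⌉₊ + 2, by positivity, Nat.ceil_pos.mpr (by positivity), ?_, ?_⟩
  · have := Nat.ceil_lt_add_one (a := K0 * ((d:ℝ) * Real.log d + 1)) (by positivity)
    linarith
  intro n hn p hp hfp
  have : Fact p.Prime := ⟨hp⟩
  have hn' : K0 * ((d:ℝ) * Real.log d + 1) ≤ n := Nat.ceil_le.mp hn
  obtain ⟨h72, hlogn, hLB, hBn, hlog⟩ := LR.analytic η c hη0 hη1 hc1 d n hd hn'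
  have hnpos : 0 < n := by omega
  apply LR.count_final (by omega) hd ε hε0 hfp
  intro f hf ℓ hℓ hℓle
  have hℓ1 : (1:ℝ) ≤ ℓ := by exact_mod_cast hℓ
  refine LR.recover hnpos hd f hf α ε hα hε (9 * d * Real.log n)
    (c + η / (18 * d) * n / Real.log n) (by positivity) (n / d) (Nat.mul_div_le n d) hlog ?_ hLB ℓ ?_
  · refine (Real.exp_le_exp.mpr hBn).trans ?_
    rw [← Real.exp_one_pow]
    gcongr
    linarith [Real.exp_one_lt_d9]
  · have h1 : (1 + ε) / (1 - α) * ℓ + 1 ≤ (2 / (1 - α) + 1) * ℓ := by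
      have : (1 + ε) / (1 - α) ≤ 2 / (1 - α) := by gcongr; linarith
      have : (1 + ε) / (1 - α) * ℓ ≤ 2 / (1 - α) * ℓ := by gcongr
      linarith
    have h0 : 0 < (1 + ε) / (1 - α) * ℓ + 1 := by positivity
    refine (Real.log_le_log h0 h1).trans ?_
    rw [Real.log_mul (by positivity) (by positivity), ← hc]
    have h2 : Real.log ℓ ≤ η / (18 * d) * n / Real.log n * Real.log 2 := by
      rw [← Real.log_rpow (by norm_num)]
      exact Real.log_le_log (by linarith) hℓle
    have h3 : η / (18 * d) * n / Real.log n * Real.log 2 ≤ η / (18 * d) * n / Real.log n * 1 := by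
      gcongr
      linarith [Real.log_two_lt_d9]
    linarith
end
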